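/- arXiv:1305.1650 — 12 statements merged into one kernel-verified Lean document; each statement's English description precedes it below -/
import Mathlib

section
/- For all integers q, r, q', r', if the standard torus maps f_{q,r} and f_{q',r'} are homotopic over S¹, then q = q' and r = r'. (Uniqueness part of the homotopy classification of fibre-preserving self-maps of the torus, Proposition 1.1.) -/
noncomputable section

/-- The circle `S¹ = ℝ/ℤ`. -/
abbrev Circle1 : Type := AddCircle (1 : ℝ)

/-- The torus, fibred over `S¹` by the first projection. -/
abbrev Torus : Type := Circle1 × Circle1

/-- Two self-maps of the torus are homotopic over `S¹` if there is a homotopy `H`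
between them with `Prod.fst ∘ H (s, ·) = Prod.fst` for every `s`. -/
def HomotopicOverCircle (f g : C(Torus, Torus)) : Prop :=
  ∃ H : ContinuousMap.Homotopy f g, ∀ (s : unitInterval) (x : Torus), (H (s, x)).1 = x.1

/-- The standard fibre-preserving map `f_{q,r} (t, z) = (t, r • t + q • z)` of the torus. -/
def torusStdMap (q r : ℤ) : C(Torus, Torus) :=
  ⟨fun x => (x.1, r • x.1 + q • x.2), by fun_prop⟩

/-- Multiplication by a nonzero integer on the circle does not lift to `ℝ`. -/
lemma eq_zero_of_coe_lift_eq_zsmul {k : ℤ} (g : C(Circle1, ℝ))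
    (hg : ∀ z, (g z : Circle1) = k • z) : k = 0 := by
  have key : (fun x : ℝ => g (x : Circle1)) = fun x : ℝ => k • x + g 0 := by
    refine (AddCircle.isCoveringMap_coe (1 : ℝ)).eq_of_comp_eq
      (g.continuous.comp (AddCircle.continuous_mk' 1)) (by fun_prop) ?_ 0 (by simp)
    funext x
    simp [hg 0, hg x]
  have h1 := congrFun key 1
  simp only [AddCircle.coe_period, zsmul_eq_mul, mul_one] at h1
  exact_mod_cast right_eq_add.mp h1

/-- Homotopic integer multiplication maps of the circle have equal degrees. -/
lemma eq_of_homotopy_zsmul {m n : ℤ} (F : C(unitInterval × Circle1, Circle1))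
    (h0 : ∀ z, F (0, z) = m • z) (h1 : ∀ z, F (1, z) = n • z) : m = n := by
  let cov := AddCircle.isCoveringMap_coe (1 : ℝ)
  let G : C(unitInterval × Circle1, Circle1) := ⟨fun x => F x - m • x.2, by fun_prop⟩
  have hG : ∀ z, G (0, z) = (((0 : C(Circle1, ℝ)) z : ℝ) : Circle1) := by
    intro z
    simp [G, h0]
  let L := cov.liftHomotopy G 0 hG
  have hk : n - m = 0 := by
    refine eq_zero_of_coe_lift_eq_zsmul (L.comp ⟨fun z => (1, z), by fun_prop⟩) fun z => ?_
    have hL : (L (1, z) : Circle1) = G (1, z) :=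
      congrFun (cov.liftHomotopy_lifts G 0 hG) (1, z)
    simpa [G, h1, sub_zsmul, ← sub_eq_add_neg] using hL
  exact (sub_eq_zero.mp hk).symm

/-- Uniqueness part of Proposition 1.1 for the torus: if the standard maps `f_{q,r}` and
`f_{q',r'}` are homotopic over `S¹`, then `q = q'` and `r = r'`. -/
theorem torus_stdMap_homotopicOver_unique (q r q' r' : ℤ)
    (h : HomotopicOverCircle (torusStdMap q r) (torusStdMap q' r')) :
    q = q' ∧ r = r' := by
  obtain ⟨H, -⟩ := h
  have h0 (x : Torus) : (H (0, x)).2 = r • x.1 + q • x.2 :=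
    congrArg Prod.snd (H.apply_zero x)
  have h1 (x : Torus) : (H (1, x)).2 = r' • x.1 + q' • x.2 :=
    congrArg Prod.snd (H.apply_one x)
  constructor
  · exact eq_of_homotopy_zsmul ⟨fun x => (H (x.1, (0, x.2))).2, by fun_prop⟩
      (fun z => by simpa using h0 (0, z)) (fun z => by simpa using h1 (0, z))
  · exact eq_of_homotopy_zsmul ⟨fun x => (H (x.1, (x.2, 0))).2, by fun_prop⟩
      (fun z => by simpa using h0 (z, 0)) (fun z => by simpa using h1 (z, 0))
end
end

section
/- Every continuous map f : T → T over S¹ is homotopic over S¹ to the standard map f_{q,r} for some integers q and r. (Existence part of the homotopy classification of fibre-preserving self-maps of the torus, Proposition 1.1.) -/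
noncomputable section

/-- Two real lifts of the same circle-valued function on a connected space differ by an integer. -/
theorem exists_int_add_of_coe_eq {X : Type*} [TopologicalSpace X] [ConnectedSpace X]
    {g h : X → ℝ} (hg : Continuous g) (hh : Continuous h)
    (hgh : ∀ x, (g x : Circle1) = h x) : ∃ n : ℤ, ∀ x, g x = h x + n := by
  have hint : ∀ x, ∃ n : ℤ, (n : ℝ) = g x - h x := fun x => by
    have hx : ((g x - h x : ℝ) : Circle1) = 0 := by
      rw [AddCircle.coe_sub, hgh, sub_self]
    obtain ⟨n, hn⟩ := (AddCircle.coe_eq_zero_iff (1 : ℝ)).1 hx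
    exact ⟨n, by simpa using hn⟩
  choose n hn using hint
  have hcont : Continuous n := by
    rw [Int.isUniformEmbedding_coe_real.isEmbedding.continuous_iff]
    exact (hg.sub hh).congr fun x => (hn x).symm
  obtain ⟨x₀⟩ := (inferInstance : Nonempty X)
  refine ⟨n x₀, fun x => ?_⟩
  rw [PreconnectedSpace.constant inferInstance hcont (x := x₀) (y := x), hn x]
  ring

/-- Every continuous circle-valued function on the plane lifts to a real-valued one. -/
theorem exists_continuous_lift_real (φ : C(ℝ × ℝ, Circle1)) :
    ∃ F : C(ℝ × ℝ, ℝ), ∀ x, (F x : Circle1) = φ x := by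
  obtain ⟨e, he⟩ := QuotientAddGroup.mk_surjective (φ 0)
  obtain ⟨F, ⟨-, hF⟩, -⟩ := (AddCircle.isCoveringMap_coe (1 : ℝ)).existsUnique_continuousMap_lifts
    φ 0 e he
  exact ⟨F, congrFun hF⟩

/-- A continuous function on the plane with period `1` in each variable descends to the torus. -/
theorem exists_continuous_torus_of_periodic (D : C(ℝ × ℝ, ℝ))
    (h₁ : ∀ a b, D (a + 1, b) = D (a, b)) (h₂ : ∀ a b, D (a, b + 1) = D (a, b)) :
    ∃ E : C(Torus, ℝ), ∀ a b : ℝ, E ((a : Circle1), (b : Circle1)) = D (a, b) := by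
  have hπ : IsOpenQuotientMap (Prod.map ((↑) : ℝ → Circle1) ((↑) : ℝ → Circle1)) :=
    QuotientAddGroup.isOpenQuotientMap_mk.prodMap QuotientAddGroup.isOpenQuotientMap_mk
  have hper : ∀ a b a' b' : ℝ, (a : Circle1) = a' → (b : Circle1) = b' → D (a, b) = D (a', b') := by
    intro a b a' b' ha hb
    obtain ⟨m, hm⟩ := (AddCircle.coe_eq_zero_iff (1 : ℝ)).1
      (show ((a - a' : ℝ) : Circle1) = 0 by rw [AddCircle.coe_sub, ha, sub_self])
    obtain ⟨n, hn⟩ := (AddCircle.coe_eq_zero_iff (1 : ℝ)).1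
      (show ((b - b' : ℝ) : Circle1) = 0 by rw [AddCircle.coe_sub, hb, sub_self])
    have p₁ : Function.Periodic (fun t => D (t, b)) 1 := fun t => h₁ t b
    have p₂ : Function.Periodic (fun t => D (a', t)) 1 := fun t => h₂ a' t
    calc D (a, b) = D (a' + m • (1 : ℝ), b) := by rw [hm]; congr 2; ring
      _ = D (a', b) := p₁.zsmul m a'
      _ = D (a', b' + n • (1 : ℝ)) := by rw [hn]; congr 2; ring
      _ = D (a', b') := p₂.zsmul n b'
  let π : C(ℝ × ℝ, Torus) := ⟨_, hπ.continuous⟩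
  have hπq : Topology.IsQuotientMap π := hπ.isQuotientMap
  have hD : Function.FactorsThrough D π := fun x y hxy =>
    hper _ _ _ _ (congrArg Prod.fst hxy) (congrArg Prod.snd hxy)
  exact ⟨hπq.lift D hD, fun a b => DFunLike.congr_fun (hπq.lift_comp D hD) (a, b)⟩

/-- Existence part of Proposition 1.1 for the torus: every continuous self-map of the torus
over `S¹` is homotopic over `S¹` to a standard map `f_{q,r}`. -/
theorem torus_homotopicOver_stdMap (f : C(Torus, Torus)) (hf : ∀ x, (f x).1 = x.1) :
    ∃ q r : ℤ, HomotopicOverCircle f (torusStdMap q r) := by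
  obtain ⟨F, hF⟩ := exists_continuous_lift_real
    ⟨fun x => (f ((x.1 : Circle1), (x.2 : Circle1))).2, by fun_prop⟩
  obtain ⟨r, hr⟩ := exists_int_add_of_coe_eq (X := ℝ × ℝ) (g := fun x => F (x.1 + 1, x.2))
    (h := F) (by fun_prop) (by fun_prop) fun x => by simp [hF]
  obtain ⟨q, hq⟩ := exists_int_add_of_coe_eq (X := ℝ × ℝ) (g := fun x => F (x.1, x.2 + 1))
    (h := F) (by fun_prop) (by fun_prop) fun x => by simp [hF]
  obtain ⟨E, hE⟩ := exists_continuous_torus_of_periodic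
    ⟨fun x => r * x.1 + q * x.2 - F x, by fun_prop⟩
    (fun a b => by have := hr (a, b); simp only [ContinuousMap.coe_mk] at this ⊢; linarith)
    (fun a b => by have := hq (a, b); simp only [ContinuousMap.coe_mk] at this ⊢; linarith)
  refine ⟨q, r, ⟨⟨fun p => (p.2.1, (f p.2).2 + ((p.1 * E p.2 : ℝ) : Circle1)), by fun_prop⟩,
    fun x => ?_, fun x => ?_⟩, fun s x => rfl⟩
  · exact Prod.ext (hf x).symm (by simp)
  · obtain ⟨a, b⟩ := x
    induction a using QuotientAddGroup.induction_on with | H a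
    induction b using QuotientAddGroup.induction_on with | H b
    refine Prod.ext rfl ?_
    have hab : (f ((a : Circle1), (b : Circle1))).2 = (F (a, b) : Circle1) := (hF (a, b)).symm
    change (f ((a : Circle1), (b : Circle1))).2
        + (((1 : unitInterval) : ℝ) * E ((a : Circle1), (b : Circle1)) : ℝ)
      = r • (a : Circle1) + q • (b : Circle1)
    rw [hab, hE, ← AddCircle.coe_zsmul, ← AddCircle.coe_zsmul, ← AddCircle.coe_add,
      ← AddCircle.coe_add]
    congr 1
    simp
end
end

section
/- For integers q, q' and r, r' ∈ {0,1}, if the standard Klein bottle maps g_{q,r} and g_{q',r'} are homotopic over S¹, then q = q' and r = r'. (Uniqueness part of the homotopy classification of fibre-preserving self-maps of the Klein bottle, Proposition 1.1.) -/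
noncomputable section

/-- The relation on `ℝ × S¹` whose quotient is the Klein bottle:
`(t, z) ∼ (t + n, (-1)ⁿ • z)` for `n : ℤ`. -/
def kleinRel : (ℝ × Circle1) → (ℝ × Circle1) → Prop :=
  fun a b => ∃ n : ℤ, b = (a.1 + n, (((-1 : ℤˣ) ^ n : ℤˣ) : ℤ) • a.2)

/-- The Klein bottle, as the quotient of `ℝ × S¹` by `kleinRel`. -/
abbrev KleinBottle : Type := Quot kleinRel

lemma coe_int_add (x : ℝ) (n : ℤ) : ((x + n : ℝ) : Circle1) = (x : Circle1) := by
  have h : ((n : ℝ) : Circle1) = 0 := by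
    rw [AddCircle.coe_eq_zero_iff]; exact ⟨n, by simp⟩
  rw [QuotientAddGroup.mk_add, h, add_zero]

/-- The half point `1/2` of `S¹`, which is its own negative. -/
def half : Circle1 := ((1/2 : ℝ) : Circle1)

lemma neg_half : -half = half := by
  rw [half, ← QuotientAddGroup.mk_neg]
  have : ((-(1/2) + 1 : ℝ) : Circle1) = ((-(1/2) : ℝ) : Circle1) := AddCircle.coe_add_period 1 _
  rw [← this]; norm_num

lemma units_smul_self_neg (u : ℤˣ) (z : Circle1) (hz : -z = z) : (u : ℤ) • z = z := by
  rcases Int.units_eq_one_or u with h | h <;> rw [h] <;> simp [hz]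

/-- The projection `p_K : K → S¹` of the Klein bottle, induced by `(t, z) ↦ (t mod 1)`. -/
def pK : C(KleinBottle, Circle1) :=
  ⟨Quot.lift (fun a => (a.1 : Circle1)) (by
      rintro a b ⟨n, rfl⟩
      exact (coe_int_add a.1 n).symm),
    continuous_quot_lift _ (continuous_coinduced_rng.comp continuous_fst)⟩

/-- A self map of the Klein bottle is a map over `S¹` if it commutes with `p_K`. -/
def KleinOverCircle (f : C(KleinBottle, KleinBottle)) : Prop := ∀ x, pK (f x) = pK x

/-- Two self-maps of `K` over `S¹` are homotopic over `S¹` if there is a homotopy between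
them through maps over `S¹`. -/
def KleinHomotopicOver (f g : C(KleinBottle, KleinBottle)) : Prop :=
  ∃ H : ContinuousMap.Homotopy f g,
    ∀ (s : unitInterval) (x : KleinBottle), pK (H (s, x)) = pK x

/-- The standard fibre-preserving self map `g_{q,r}` of the Klein bottle, induced by
`(t, z) ↦ (t, q • z + r • (1/2))`. -/
def kleinStdMap (q r : ℤ) : C(KleinBottle, KleinBottle) :=
  ⟨Quot.lift (fun a => Quot.mk kleinRel (a.1, q • a.2 + r • half))
    (by
      rintro a b ⟨n, rfl⟩
      apply Quot.sound
      refine ⟨n, ?_⟩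
      simp only [Prod.mk.injEq, true_and]
      rw [smul_add, smul_comm ((((-1 : ℤˣ) ^ n : ℤˣ) : ℤ)) q,
        units_smul_self_neg _ (r • half) (by rw [← smul_neg, neg_half])]),
    continuous_quot_lift _ ((continuous_quot_mk).comp (by fun_prop))⟩


lemma kleinRel_equivalence : Equivalence kleinRel where
  refl a := ⟨0, by simp⟩
  symm := by
    rintro a _ ⟨n, rfl⟩
    refine ⟨-n, ?_⟩
    rcases Int.units_eq_one_or ((-1 : ℤˣ) ^ n) with h | h <;> simp [zpow_neg, h]
  trans := by
    rintro a _ _ ⟨n, rfl⟩ ⟨m, rfl⟩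
    refine ⟨n + m, ?_⟩
    simp only [Int.cast_add, zpow_add, Units.val_mul, mul_smul, add_assoc]
    rw [smul_comm]

lemma kleinMk_eq_iff {a b : ℝ × Circle1} :
    Quot.mk kleinRel a = Quot.mk kleinRel b ↔ kleinRel a b :=
  ⟨fun h => kleinRel_equivalence.eqvGen_iff.1 (Quot.eqvGen_exact h), Quot.sound⟩

/-- In a fibre of the Klein bottle, points over nearby parameters have no further
identification: only the trivial deck transformation moves `t` by less than `1`. -/
lemma eq_of_kleinMk_eq {t t' : ℝ} {w w' : Circle1} (ht : |t' - t| < 1)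
    (h : Quot.mk kleinRel (t, w) = Quot.mk kleinRel (t', w')) : w = w' := by
  obtain ⟨n, hn⟩ := kleinMk_eq_iff.1 h
  simp only [Prod.mk.injEq] at hn
  obtain ⟨h1, h2⟩ := hn
  have hn : n = 0 := by
    rw [h1, add_sub_cancel_left] at ht
    exact Int.abs_lt_one_iff.1 (by exact_mod_cast ht)
  simpa [hn] using h2.symm

lemma exists_eq_kleinMk (y : KleinBottle) (t : ℝ) (h : pK y = (t : Circle1)) :
    ∃ w : Circle1, Quot.mk kleinRel (t, w) = y := by
  obtain ⟨⟨u, z⟩, rfl⟩ := Quot.exists_rep y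
  have h' : ((t - u : ℝ) : Circle1) = 0 := by
    rw [QuotientAddGroup.mk_sub, ← h]
    exact sub_self (u : Circle1)
  obtain ⟨n, hn⟩ := (AddCircle.coe_eq_zero_iff _).1 h'
  refine ⟨(((-1 : ℤˣ) ^ n : ℤˣ) : ℤ) • z, (Quot.sound ⟨n, ?_⟩).symm⟩
  have : t = u + n := by simp at hn; linarith
  simp [this]

lemma isOpenMap_kleinMk : IsOpenMap (Quot.mk kleinRel) := by
  intro U hU
  rw [← isQuotientMap_quot_mk.isOpen_preimage]
  have : Quot.mk kleinRel ⁻¹' (Quot.mk kleinRel '' U) =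
      ⋃ n : ℤ, (fun a : ℝ × Circle1 => (a.1 + n, (((-1 : ℤˣ) ^ n : ℤˣ) : ℤ) • a.2)) ⁻¹' U := by
    ext a
    simp only [Set.mem_preimage, Set.mem_image, Set.mem_iUnion]
    constructor
    · rintro ⟨b, hb, hab⟩
      obtain ⟨n, rfl⟩ := kleinMk_eq_iff.1 hab.symm
      exact ⟨n, hb⟩
    · rintro ⟨n, hn⟩
      exact ⟨_, hn, (Quot.sound ⟨n, rfl⟩).symm⟩
  rw [this]
  exact isOpen_iUnion fun n => hU.preimage (by fun_prop)

/-- The fibre coordinate of a continuous family of points of the Klein bottle is continuous. -/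
lemma continuous_of_kleinMk {X : Type*} [TopologicalSpace X] {τ : X → ℝ} {w : X → Circle1}
    (hτ : Continuous τ) (h : Continuous fun x => Quot.mk kleinRel (τ x, w x)) :
    Continuous w := by
  rw [continuous_iff_continuousAt]
  intro x V hV
  obtain ⟨U, hUV, hU, hxU⟩ := mem_nhds_iff.1 hV
  have h1 : ∀ᶠ x' in nhds x, τ x' ∈ Metric.ball (τ x) (1 / 2) :=
    hτ.continuousAt (Metric.ball_mem_nhds _ (by norm_num))
  have h2 : ∀ᶠ x' in nhds x, Quot.mk kleinRel (τ x', w x') ∈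
      Quot.mk kleinRel '' (Metric.ball (τ x) (1 / 2) ×ˢ U) :=
    h.continuousAt ((isOpenMap_kleinMk _ (Metric.isOpen_ball.prod hU)).mem_nhds
      ⟨_, ⟨Metric.mem_ball_self (by norm_num), hxU⟩, rfl⟩)
  change ∀ᶠ x' in nhds x, w x' ∈ V
  filter_upwards [h1, h2] with x' hx1 hx2
  obtain ⟨⟨t, z⟩, ⟨ht, hz⟩, heq⟩ := hx2
  have hlt : |τ x' - t| < 1 := by
    have := dist_triangle_right (τ x') t (τ x)
    rw [Metric.mem_ball] at hx1 ht
    rw [← Real.dist_eq]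
    linarith
  exact hUV (eq_of_kleinMk_eq hlt heq ▸ hz)

/-- A continuous real function with values in `ℤ` on a preconnected space is constant. -/
lemma eq_of_coe_circle_eq_zero {X : Type*} [TopologicalSpace X] [PreconnectedSpace X]
    {g : X → ℝ} (hg : Continuous g) (h : ∀ x, (g x : Circle1) = 0) (x y : X) : g x = g y := by
  have h' : ∀ x, ∃ n : ℤ, (n : ℝ) = g x := fun x => by
    simpa using (AddCircle.coe_eq_zero_iff _).1 (h x)
  choose k hk using h'
  have hkc : Continuous k := by
    rw [Int.isClosedEmbedding_coe_real.isInducing.continuous_iff]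
    exact hg.congr fun x => (hk x).symm
  rw [← hk, ← hk, PreconnectedSpace.constant inferInstance hkc]

/-- A homotopy over the circle between standard maps lifts to a real-valued homotopy of fibre
coordinates. -/
lemma exists_lift_of_kleinHomotopicOver {q q' r r' : ℤ}
    (h : KleinHomotopicOver (kleinStdMap q r) (kleinStdMap q' r')) :
    ∃ F : C(unitInterval × (ℝ × ℝ), ℝ),
      (∀ t x, F (0, t, x) = q * x + r * (1 / 2)) ∧
      (∀ t x, (F (1, t, x) : Circle1) = ((q' * x + r' * (1 / 2) : ℝ) : Circle1)) ∧
      (∀ s t x, (F (s, t, x + 1) : Circle1) = F (s, t, x)) ∧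
      (∀ s t x, (F (s, t + 1, -x) : Circle1) = -(F (s, t, x) : Circle1)) := by
  obtain ⟨H, hH⟩ := h
  have hw : ∀ p : unitInterval × (ℝ × ℝ), ∃ w : Circle1,
      Quot.mk kleinRel (p.2.1, w) = H (p.1, Quot.mk kleinRel (p.2.1, (p.2.2 : Circle1))) :=
    fun p => exists_eq_kleinMk _ _ (hH _ _)
  choose w hw using hw
  have hwc : Continuous w := by
    refine continuous_of_kleinMk (τ := fun p => p.2.1) (by fun_prop) ?_
    simp only [hw]
    have hmk : Continuous fun p : unitInterval × (ℝ × ℝ) =>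
        Quot.mk kleinRel (p.2.1, (p.2.2 : Circle1)) :=
      continuous_quot_mk.comp (by fun_prop)
    fun_prop
  have uniq : ∀ {t : ℝ} {a b : Circle1},
      Quot.mk kleinRel (t, a) = Quot.mk kleinRel (t, b) → a = b :=
    fun h => eq_of_kleinMk_eq (by simp) h
  have hstd : ∀ (m n : ℤ) (x : ℝ),
      ((m * x + n * (1 / 2) : ℝ) : Circle1) = m • (x : Circle1) + n • half := fun m n x => by
    simp [half, ← zsmul_eq_mul]
  have w0 : ∀ t x, w (0, t, x) = ((q * x + r * (1 / 2) : ℝ) : Circle1) := fun t x =>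
    uniq ((hw _).trans (by rw [H.apply_zero, hstd]; rfl))
  have w1 : ∀ t x, w (1, t, x) = ((q' * x + r' * (1 / 2) : ℝ) : Circle1) := fun t x =>
    uniq ((hw _).trans (by rw [H.apply_one, hstd]; rfl))
  have wper : ∀ s t x, w (s, t, x + 1) = w (s, t, x) := fun s t x =>
    uniq ((hw _).trans (by
      simp only [AddCircle.coe_add_period]
      exact (hw (s, t, x)).symm))
  have flip : ∀ (t : ℝ) (z : Circle1),
      Quot.mk kleinRel (t + 1, -z) = Quot.mk kleinRel (t, z) := fun t z =>
    (Quot.sound ⟨1, by simp⟩).symm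
  have wflip : ∀ s t x, w (s, t + 1, -x) = -w (s, t, x) := fun s t x =>
    uniq ((hw _).trans (by
      simp only [flip, QuotientAddGroup.mk_neg]
      exact (hw (s, t, x)).symm))
  have cov : IsCoveringMap ((↑) : ℝ → Circle1) := AddCircle.isCoveringMap_coe 1
  let W : C(unitInterval × (ℝ × ℝ), Circle1) := ⟨w, hwc⟩
  let f : C(ℝ × ℝ, ℝ) := ⟨fun p => q * p.2 + r * (1 / 2), by fun_prop⟩
  have hWf : ∀ a, W (0, a) = (f a : Circle1) := fun a => w0 a.1 a.2
  have hlift : ∀ p, ((cov.liftHomotopy W f hWf p : ℝ) : Circle1) = w p :=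
    congr_fun (cov.liftHomotopy_lifts W f hWf)
  refine ⟨cov.liftHomotopy W f hWf, fun t x => cov.liftHomotopy_zero W f hWf (t, x), ?_, ?_, ?_⟩
  · intro t x
    rw [hlift, w1]
  · intro s t x
    rw [hlift, hlift, wper]
  · intro s t x
    rw [hlift, hlift, wflip]

/-- Uniqueness part of Proposition 1.1 for the Klein bottle: for `r, r' ∈ {0, 1}`, if the
standard maps `g_{q,r}` and `g_{q',r'}` are homotopic over `S¹`, then `q = q'` and `r = r'`. -/
theorem klein_stdMap_homotopicOver_unique (q q' r r' : ℤ)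
    (hr : r = 0 ∨ r = 1) (hr' : r' = 0 ∨ r' = 1)
    (h : KleinHomotopicOver (kleinStdMap q r) (kleinStdMap q' r')) :
    q = q' ∧ r = r' := by
  obtain ⟨F, h0, h1, hper, hflip⟩ := exists_lift_of_kleinHomotopicOver h
  have hend : ∀ x y : ℝ, F (1, 0, x) - (q' * x + r' * (1 / 2)) =
      F (1, y, 0) - (q' * 0 + r' * (1 / 2)) := fun x y =>
    eq_of_coe_circle_eq_zero (X := ℝ × ℝ)
      (g := fun p => F (1, p.1, p.2) - (q' * p.2 + r' * (1 / 2))) (by fun_prop)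
      (fun p => by rw [QuotientAddGroup.mk_sub, h1, sub_self]) (0, x) (y, 0)
  have hdeg : F (1, 0, 0 + 1) - F (1, 0, 0) = F (0, 0, 0 + 1) - F (0, 0, 0) :=
    eq_of_coe_circle_eq_zero (g := fun s => F (s, 0, 0 + 1) - F (s, 0, 0)) (by fun_prop)
      (fun s => by rw [QuotientAddGroup.mk_sub, hper, sub_self]) 1 0
  have hsum : F (1, 0 + 1, -0) + F (1, 0, 0) = F (0, 0 + 1, -0) + F (0, 0, 0) :=
    eq_of_coe_circle_eq_zero (g := fun s => F (s, 0 + 1, -0) + F (s, 0, 0)) (by fun_prop)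
      (fun s => by rw [QuotientAddGroup.mk_add, hflip, neg_add_cancel]) 1 0
  have hint : ((F (1, 0, 0) - (q' * 0 + r' * (1 / 2)) : ℝ) : Circle1) = 0 := by
    rw [QuotientAddGroup.mk_sub, h1, sub_self]
  obtain ⟨k, hk⟩ := (AddCircle.coe_eq_zero_iff _).1 hint
  have e1 := hend 1 0
  have e2 := hend 0 1
  simp only [h0, zero_add, neg_zero, zsmul_eq_mul] at hdeg hsum hk
  constructor
  · have : (q : ℝ) = q' := by linarith
    exact_mod_cast this
  · have : (r : ℝ) = r' + 2 * k := by linarith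
    have : r = r' + 2 * k := by exact_mod_cast this
    omega
end
end

section
/- Every continuous map f : K → K over S¹ is homotopic over S¹ to the standard map g_{q,r} for some integer q and some r ∈ {0,1}. (Existence part of the homotopy classification of fibre-preserving self-maps of the Klein bottle, Proposition 1.1.) -/
noncomputable section

lemma exists_int_of_coe_eq_coe {x y : ℝ} (h : (x : Circle1) = y) : ∃ n : ℤ, y = x + n := by
  have h' : ((y - x : ℝ) : Circle1) = 0 := by rw [AddCircle.coe_sub, h, sub_self]
  obtain ⟨n, hn⟩ := (AddCircle.coe_eq_zero_iff 1).1 h'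
  refine ⟨n, ?_⟩
  rw [zsmul_eq_mul, mul_one] at hn
  linarith

lemma kleinRel_of_mk_eq {a b : ℝ × Circle1} (h : Quot.mk kleinRel a = Quot.mk kleinRel b) :
    kleinRel a b :=
  kleinRel_equivalence.eqvGen_iff.1 (Quot.eqvGen_exact h)

/-- The quotient map `ℝ × S¹ → K` is open. -/
lemma isOpenQuotientMap_kleinMk : IsOpenQuotientMap (Quot.mk kleinRel) := by
  refine ⟨Quot.mk_surjective, continuous_quot_mk, fun W hW => ?_⟩
  rw [← isQuotientMap_quot_mk.isOpen_preimage]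
  have h : Quot.mk kleinRel ⁻¹' (Quot.mk kleinRel '' W) =
      ⋃ n : ℤ, (fun a : ℝ × Circle1 => (a.1 + n, (((-1 : ℤˣ) ^ n : ℤˣ) : ℤ) • a.2)) ⁻¹' W := by
    ext a
    simp only [Set.mem_preimage, Set.mem_image, Set.mem_iUnion]
    constructor
    · rintro ⟨b, hb, hba⟩
      obtain ⟨n, rfl⟩ := kleinRel_of_mk_eq hba.symm
      exact ⟨n, hb⟩
    · rintro ⟨n, hn⟩
      exact ⟨_, hn, (Quot.sound ⟨n, rfl⟩).symm⟩
  rw [h]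
  exact isOpen_iUnion fun n => hW.preimage (by fun_prop)

lemma kleinMk_injective_fibre {t : ℝ} {w w' : Circle1}
    (h : Quot.mk kleinRel (t, w) = Quot.mk kleinRel (t, w')) : w = w' := by
  obtain ⟨n, hn⟩ := kleinRel_of_mk_eq h
  rw [Prod.mk.injEq] at hn
  have hn0 : n = 0 := by simpa using hn.1
  simpa [hn0] using hn.2.symm

/-- A point of `K` over `t mod 1` is represented by a point of `{t} × S¹`. -/
lemma exists_kleinMk_eq {t : ℝ} {k : KleinBottle} (hk : pK k = (t : Circle1)) :
    ∃ w, k = Quot.mk kleinRel (t, w) := by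
  obtain ⟨⟨t', w'⟩, rfl⟩ := Quot.mk_surjective k
  obtain ⟨n, hn⟩ := exists_int_of_coe_eq_coe (x := t') (y := t) hk
  exact ⟨_, Quot.sound ⟨n, Prod.ext hn rfl⟩⟩

/-- A self-map of `K` over `S¹` lifts to a fibre-preserving self-map of `ℝ × S¹`. -/
lemma exists_fibre_map (f : C(KleinBottle, KleinBottle)) (hf : KleinOverCircle f) :
    ∃ φ : C(ℝ × Circle1, Circle1),
      ∀ a, f (Quot.mk kleinRel a) = Quot.mk kleinRel (a.1, φ a) := by
  choose φ hφ using fun a : ℝ × Circle1 => exists_kleinMk_eq (hf (Quot.mk kleinRel a))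
  refine ⟨⟨φ, continuous_iff_continuousAt.2 fun a => ?_⟩, hφ⟩
  rw [ContinuousAt, (nhds_basis_opens (φ a)).tendsto_right_iff]
  rintro V ⟨haV, hV⟩
  have hopen := isOpenQuotientMap_kleinMk.isOpenMap _
    ((Metric.isOpen_ball (x := a.1) (ε := 1 / 2)).prod hV)
  have hcont : Continuous fun b : ℝ × Circle1 => f (Quot.mk kleinRel b) :=
    f.continuous.comp continuous_quot_mk
  have hmem : f (Quot.mk kleinRel a) ∈
      Quot.mk kleinRel '' (Metric.ball a.1 (1 / 2) ×ˢ V) :=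
    ⟨(a.1, φ a), ⟨Metric.mem_ball_self (by norm_num), haV⟩, (hφ a).symm⟩
  filter_upwards [hcont.continuousAt.preimage_mem_nhds (hopen.mem_nhds hmem),
    continuous_fst.continuousAt.preimage_mem_nhds
      (Metric.ball_mem_nhds a.1 (by norm_num : (0 : ℝ) < 1 / 2))] with b hb hb'
  obtain ⟨⟨t, w⟩, ⟨ht, hw⟩, htw⟩ := hb
  obtain ⟨n, hn⟩ := kleinRel_of_mk_eq (htw.trans (hφ b))
  rw [Prod.mk.injEq] at hn
  have hn0 : n = 0 := by
    simp only [Metric.mem_ball, Set.mem_preimage, Real.dist_eq, abs_lt] at ht hb'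
    have h1 : (n : ℝ) < 1 := by linarith [hn.1]
    have h2 : (-1 : ℝ) < n := by linarith [hn.1]
    have h1' : n < 1 := by exact_mod_cast h1
    have h2' : -1 < n := by exact_mod_cast h2
    omega
  have : φ b = w := by simpa [hn0] using hn.2
  rwa [this]

/-- Two real functions on a connected space that agree modulo `1` differ by an integer. -/
lemma exists_int_eq_add {X : Type*} [TopologicalSpace X] [ConnectedSpace X] {F₁ F₂ : X → ℝ}
    (h₁ : Continuous F₁) (h₂ : Continuous F₂) (h : ∀ x, (F₁ x : Circle1) = F₂ x) :
    ∃ n : ℤ, ∀ x, F₁ x = F₂ x + n := by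
  obtain ⟨x₀⟩ : Nonempty X := inferInstance
  obtain ⟨n, hn⟩ := exists_int_of_coe_eq_coe (h x₀).symm
  refine ⟨n, fun x => ?_⟩
  have hcov : IsCoveringMap ((↑) : ℝ → Circle1) := AddCircle.isCoveringMap_coe 1
  have := hcov.const_of_comp (h₁.sub h₂) (fun a a' => by
    simp only [Pi.sub_apply, AddCircle.coe_sub, h, sub_self]) x x₀
  simp only [Pi.sub_apply] at this
  linarith

/-- A continuous map `ℝ × S¹ → S¹` equivariant for the deck transformation
`(t, z) ↦ (t + 1, -z)` differs from a standard one by the class of an equivariant real function. -/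
lemma exists_equivariant_decomposition (φ : C(ℝ × Circle1, Circle1))
    (hφ : ∀ t z, φ (t + 1, -z) = -φ (t, z)) :
    ∃ q r : ℤ, (r = 0 ∨ r = 1) ∧ ∃ G : C(ℝ × Circle1, ℝ),
      (∀ t z, φ (t, z) = q • z + r • half + (G (t, z) : Circle1)) ∧
      ∀ t z, G (t + 1, -z) = -G (t, z) := by
  have hcov : IsCoveringMap ((↑) : ℝ → Circle1) := AddCircle.isCoveringMap_coe 1
  let ψ : C(ℝ × ℝ, Circle1) := ⟨fun a => φ (a.1, (a.2 : Circle1)), by fun_prop⟩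
  obtain ⟨e₀, he₀⟩ := QuotientAddGroup.mk_surjective (ψ 0)
  obtain ⟨F, ⟨-, hF⟩, -⟩ := hcov.existsUnique_continuousMap_lifts ψ 0 e₀ he₀
  replace hF : ∀ t x, (F (t, x) : Circle1) = φ (t, (x : Circle1)) :=
    fun t x => congrFun hF (t, x)
  obtain ⟨q, hq⟩ := exists_int_eq_add (F₁ := fun a : ℝ × ℝ => F (a.1, a.2 + 1)) (F₂ := F)
    (by fun_prop) (by fun_prop) fun a => by
      rw [hF, AddCircle.coe_add_period, ← hF]
  obtain ⟨c, hc⟩ := exists_int_eq_add (F₁ := fun a : ℝ × ℝ => F (a.1 + 1, -a.2))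
    (F₂ := fun a => -F a) (by fun_prop) (by fun_prop) fun a => by
      rw [hF, AddCircle.coe_neg, AddCircle.coe_neg, hφ, ← hF]
  let g : ℝ × ℝ → ℝ := fun a => F a - q * a.2 - c / 2
  have hg : ∀ t, Function.Periodic (fun x => g (t, x)) 1 := fun t x => by
    have := hq (t, x)
    simp only [g] at this ⊢
    linarith
  have hquot : IsOpenQuotientMap (Prod.map id (↑) : ℝ × ℝ → ℝ × Circle1) :=
    IsOpenQuotientMap.id.prodMap QuotientAddGroup.isOpenQuotientMap_mk
  let G : C(ℝ × Circle1, ℝ) := ⟨fun a => (hg a.1).lift a.2,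
    hquot.continuous_comp_iff.1 (show Continuous g by fun_prop)⟩
  have hG : ∀ t x : ℝ, G (t, (x : Circle1)) = F (t, x) - q * x - c / 2 := fun t x => rfl
  have hhalf : ((c / 2 : ℝ) : Circle1) = (c % 2) • half := by
    have : (c : ℝ) / 2 = (c % 2 : ℤ) • (1 / 2 : ℝ) + (c / 2 : ℤ) := by
      have := Int.emod_add_mul_ediv c 2
      have h' : ((c % 2 : ℤ) : ℝ) + 2 * ((c / 2 : ℤ) : ℝ) = c := by exact_mod_cast this
      rw [zsmul_eq_mul]
      linarith
    rw [this, coe_int_add, AddCircle.coe_zsmul, half]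
  refine ⟨q, c % 2, Int.emod_two_eq_zero_or_one c, G, fun t z => ?_, fun t z => ?_⟩
  · obtain ⟨x, rfl⟩ := QuotientAddGroup.mk_surjective z
    have h1 : F (t, x) = q • x + c / 2 + G (t, (x : Circle1)) := by
      rw [hG, zsmul_eq_mul]; ring
    change φ (t, (x : Circle1)) = q • (x : Circle1) + _ + (G (t, (x : Circle1)) : Circle1)
    rw [← hF, h1, AddCircle.coe_add, AddCircle.coe_add, hhalf, AddCircle.coe_zsmul]
  · obtain ⟨x, rfl⟩ := QuotientAddGroup.mk_surjective z
    change G (t + 1, -(x : Circle1)) = -G (t, (x : Circle1))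
    rw [← AddCircle.coe_neg, hG, hG]
    have := hc (t, x)
    simp only at this
    rw [this]
    ring

lemma equivariant_of_generator {M : Type*} [AddCommGroup M] {G : ℝ × Circle1 → M}
    (hG : ∀ t z, G (t + 1, -z) = -G (t, z)) (n : ℤ) (t : ℝ) (z : Circle1) :
    G (t + n, (((-1 : ℤˣ) ^ n : ℤˣ) : ℤ) • z) = (((-1 : ℤˣ) ^ n : ℤˣ) : ℤ) • G (t, z) := by
  induction n with
  | zero => simp
  | succ n ih =>
    rw [zpow_add_one]
    push_cast at ih ⊢
    rw [mul_neg_one, neg_smul, neg_smul, ← add_assoc, hG, ih]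
  | pred n ih =>
    rw [zpow_sub_one]
    push_cast at ih ⊢
    have h := hG (t + (-(n : ℝ) - 1)) ((((-1 : ℤˣ) ^ (-(n : ℤ)) : ℤˣ) : ℤ) • -z)
    rw [smul_neg, neg_neg, add_assoc, sub_add_cancel, ih] at h
    simp only [inv_neg, inv_one, Units.val_neg, Units.val_one, mul_neg_one, neg_smul]
    rw [h, neg_neg]

/-- A self-map of `K` that differs from `g_{q,r}` fibrewise by an equivariant real function is
homotopic to `g_{q,r}` over `S¹`, by shrinking that function linearly. -/
lemma kleinHomotopicOver_stdMap_of_decomposition {f : C(KleinBottle, KleinBottle)} {q r : ℤ}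
    (G : C(ℝ × Circle1, ℝ)) (hG : ∀ t z, G (t + 1, -z) = -G (t, z))
    (hf : ∀ t z, f (Quot.mk kleinRel (t, z)) =
      Quot.mk kleinRel (t, q • z + r • half + (G (t, z) : Circle1))) :
    KleinHomotopicOver f (kleinStdMap q r) := by
  let h : unitInterval → ℝ × Circle1 → KleinBottle := fun s a =>
    Quot.mk kleinRel (a.1, q • a.2 + r • half + (((1 - s) * G a : ℝ) : Circle1))
  have hrel : ∀ s a b, kleinRel a b → h s a = h s b := by
    rintro s ⟨t, z⟩ _ ⟨n, rfl⟩
    refine Quot.sound ⟨n, ?_⟩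
    simp only [Prod.mk.injEq, true_and]
    rw [equivariant_of_generator hG, smul_add, smul_add,
      smul_comm ((((-1 : ℤˣ) ^ n : ℤˣ) : ℤ)) q,
      units_smul_self_neg _ (r • half) (by rw [← smul_neg, neg_half]),
      ← AddCircle.coe_zsmul, mul_smul_comm]
  have hcont : Continuous fun p : unitInterval × KleinBottle => Quot.lift (h p.1) (hrel p.1) p.2 :=
    (IsOpenQuotientMap.id.prodMap isOpenQuotientMap_kleinMk).continuous_comp_iff.1
      (show Continuous fun p : unitInterval × (ℝ × Circle1) => h p.1 p.2 from
        continuous_quot_mk.comp (by fun_prop))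
  refine ⟨⟨⟨_, hcont⟩, ?_, ?_⟩, ?_⟩
  · rintro ⟨t, z⟩
    change h 0 (t, z) = f (Quot.mk kleinRel (t, z))
    simp [h, hf]
  · rintro ⟨t, z⟩
    change h 1 (t, z) = Quot.mk kleinRel (t, q • z + r • half)
    simp [h]
  · rintro s ⟨t, z⟩
    rfl

/-- Existence part of Proposition 1.1 for the Klein bottle: every continuous self-map of the
Klein bottle over `S¹` is homotopic over `S¹` to a standard map `g_{q,r}` with `r ∈ {0, 1}`. -/
theorem klein_homotopicOver_stdMap (f : C(KleinBottle, KleinBottle))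
    (hf : KleinOverCircle f) :
    ∃ q r : ℤ, (r = 0 ∨ r = 1) ∧ KleinHomotopicOver f (kleinStdMap q r) := by
  obtain ⟨φ, hφ⟩ := exists_fibre_map f hf
  have hrel : ∀ t z, Quot.mk kleinRel (t, z) = Quot.mk kleinRel (t + 1, -z) :=
    fun t z => Quot.sound ⟨1, by simp⟩
  obtain ⟨q, r, hr, G, hφG, hG⟩ := exists_equivariant_decomposition φ fun t z =>
    kleinMk_injective_fibre (t := t + 1) (by
      rw [← hrel t (φ (t, z)), ← hφ (t, z), hrel t z, hφ])
  exact ⟨q, r, hr, kleinHomotopicOver_stdMap_of_decomposition G hG fun t z => by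
    rw [hφ, hφG]⟩
end
end

section
/- Every continuous map f : T → K over S¹ (i.e. with p_K ∘ f = Prod.fst) is homotopic over S¹ to exactly one of the two maps s_0 ∘ Prod.fst and s_{1/2} ∘ Prod.fst, where s_0, s_{1/2} : S¹ → K are the sections induced by t ↦ (t, 0) and t ↦ (t, 1/2); in particular s_0 ∘ Prod.fst and s_{1/2} ∘ Prod.fst are not homotopic over S¹. (Proposition 1.1 for maps from the torus to the Klein bottle: such maps are classified by r ∈ ℤ/2 and have fibre degree q = 0.) -/
noncomputable section

/-- The section `s_c : S¹ → K` induced by `t ↦ (t, c)`, well defined whenever `-c = c`. -/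
def kleinSection (c : Circle1) (hc : -c = c) : C(Circle1, KleinBottle) :=
  ⟨Quotient.lift (fun t : ℝ => Quot.mk kleinRel (t, c))
    (by
      intro a b hab
      obtain ⟨n, hn⟩ := QuotientAddGroup.leftRel_apply.mp hab
      apply Quot.sound
      refine ⟨n, ?_⟩
      have hb : b = a + n := by simp only [zsmul_eq_mul, mul_one] at hn; linarith [hn]
      rw [hb, units_smul_self_neg _ c hc]),
    Continuous.quotient_lift (continuous_quot_mk.comp (by fun_prop)) _⟩

/-- A map `f : T → K` is a map over `S¹` if `p_K ∘ f = Prod.fst`. -/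
def TKOverCircle (f : C(Torus, KleinBottle)) : Prop := ∀ x, pK (f x) = x.1

/-- Two maps `T → K` over `S¹` are homotopic over `S¹` if there is a homotopy between them
through maps over `S¹`. -/
def TKHomotopicOver (f g : C(Torus, KleinBottle)) : Prop :=
  ∃ H : ContinuousMap.Homotopy f g,
    ∀ (s : unitInterval) (x : Torus), pK (H (s, x)) = x.1

/-- The map `s_0 ∘ Prod.fst : T → K`. -/
def sectionZeroFst : C(Torus, KleinBottle) :=
  (kleinSection 0 neg_zero).comp ⟨Prod.fst, continuous_fst⟩

/-- The map `s_{1/2} ∘ Prod.fst : T → K`. -/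
def sectionHalfFst : C(Torus, KleinBottle) :=
  (kleinSection half neg_half).comp ⟨Prod.fst, continuous_fst⟩

/-- The action of `ℤ` on `ℝ × S¹` by `n +ᵥ (t, z) = (t + n, (-1)ⁿ • z)`. -/
abbrev kleinAction : AddAction ℤ (ℝ × Circle1) where
  vadd n a := (a.1 + n, (((-1 : ℤˣ) ^ n : ℤˣ) : ℤ) • a.2)
  zero_vadd a := by
    change (a.1 + ((0 : ℤ) : ℝ), (((-1 : ℤˣ) ^ (0 : ℤ) : ℤˣ) : ℤ) • a.2) = a
    simp
  add_vadd m n a := by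
    change (a.1 + ((m + n : ℤ) : ℝ), (((-1 : ℤˣ) ^ (m + n) : ℤˣ) : ℤ) • a.2) =
      (a.1 + (n : ℝ) + (m : ℝ),
        (((-1 : ℤˣ) ^ m : ℤˣ) : ℤ) • (((-1 : ℤˣ) ^ n : ℤˣ) : ℤ) • a.2)
    rw [zpow_add, Units.val_mul, mul_smul]
    push_cast
    rw [add_assoc, add_comm (n : ℝ)]

lemma isCoveringMap_kleinMk : IsCoveringMap (Quot.mk kleinRel) := by
  let := kleinAction
  have h : IsAddQuotientCoveringMap (Quot.mk kleinRel) ℤ :=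
    { isQuotientMap_quot_mk with
      continuous_const_vadd := fun n => by
        change Continuous fun a : ℝ × Circle1 =>
          (a.1 + (n : ℝ), (((-1 : ℤˣ) ^ n : ℤˣ) : ℤ) • a.2)
        fun_prop
      apply_eq_iff_mem_orbit := fun {a b} => by
        rw [eq_comm, kleinMk_eq_iff]
        exact ⟨fun ⟨n, hn⟩ => ⟨n, hn.symm⟩, fun ⟨n, hn⟩ => ⟨n, hn.symm⟩⟩
      disjoint := fun e => by
        refine ⟨Prod.fst ⁻¹' Metric.ball e.1 (1 / 2),
          continuous_fst.continuousAt.preimage_mem_nhds (Metric.ball_mem_nhds _ (by norm_num)), ?_⟩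
        rintro n ⟨_, ⟨a, ha, rfl⟩, hb⟩
        replace hb : a.1 + (n : ℝ) ∈ Metric.ball e.1 (1 / 2) := hb
        replace ha : a.1 ∈ Metric.ball e.1 (1 / 2) := ha
        rw [Metric.mem_ball, Real.dist_eq, abs_lt] at ha hb
        have h₁ : (n : ℝ) < 1 := by linarith
        have h₂ : (-1 : ℝ) < n := by linarith
        have h₃ : n < 1 := by exact_mod_cast h₁
        have h₄ : -1 < n := by exact_mod_cast h₂
        omega }
  exact h.isCoveringMap

lemma circle_coe_eq_iff {a b : ℝ} : (a : Circle1) = b ↔ ∃ m : ℤ, a - b = m := by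
  rw [← sub_eq_zero, ← AddCircle.coe_sub, AddCircle.coe_eq_zero_iff]
  simp [eq_comm]

/-- The universal cover `ℝ × ℝ → K` of the Klein bottle. -/
def kleinCover (t a : ℝ) : KleinBottle := Quot.mk kleinRel (t, (a : Circle1))

lemma continuous_kleinCover : Continuous fun p : ℝ × ℝ => kleinCover p.1 p.2 :=
  continuous_quot_mk.comp
    (continuous_fst.prodMk ((AddCircle.continuous_mk' 1).comp continuous_snd))

lemma pK_kleinCover (t a : ℝ) : pK (kleinCover t a) = t := rfl

lemma kleinCover_eq_iff {t a b : ℝ} :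
    kleinCover t a = kleinCover t b ↔ ∃ m : ℤ, a - b = m := by
  rw [← circle_coe_eq_iff, kleinCover, kleinCover, kleinMk_eq_iff]
  constructor
  · rintro ⟨n, hn⟩
    obtain ⟨h₁, h₂⟩ := Prod.mk.inj hn
    have h₃ : n = 0 := by simpa using h₁
    simpa [h₃] using h₂.symm
  · intro h
    exact ⟨0, by simp [h]⟩

lemma kleinCover_add_one_eq_iff {t a b : ℝ} :
    kleinCover (t + 1) a = kleinCover t b ↔ ∃ m : ℤ, a + b = m := by
  have h : kleinCover t b = kleinCover (t + 1) (-b) :=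
    Quot.sound ⟨1, by simp⟩
  rw [h, kleinCover_eq_iff, sub_neg_eq_add]

lemma exists_kleinCover_lift (g : C(ℝ × ℝ, KleinBottle)) (τ : C(ℝ × ℝ, ℝ))
    (h : ∀ x, pK (g x) = τ x) : ∃ ψ : C(ℝ × ℝ, ℝ), ∀ x, g x = kleinCover (τ x) (ψ x) := by
  obtain ⟨e, he, heτ⟩ : ∃ e : ℝ × Circle1, Quot.mk kleinRel e = g 0 ∧ e.1 = τ 0 := by
    obtain ⟨⟨t, z⟩, hz⟩ := Quot.exists_rep (g 0)
    have h₀ := h 0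
    rw [← hz] at h₀
    obtain ⟨m, hm⟩ := circle_coe_eq_iff.1 h₀.symm
    refine ⟨_, (Quot.sound ⟨m, rfl⟩ : Quot.mk kleinRel (t, z) = _).symm.trans hz, ?_⟩
    simp only
    linarith
  obtain ⟨F, ⟨hF₀, hF⟩, -⟩ := isCoveringMap_kleinMk.existsUnique_continuousMap_lifts g 0 e he
  have hτ : (fun x => (F x).1) = τ := by
    refine (AddCircle.isCoveringMap_coe (1 : ℝ)).eq_of_comp_eq (continuous_fst.comp F.continuous)
      τ.continuous ?_ 0 (by rw [hF₀, heτ])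
    funext x
    rw [Function.comp_apply, Function.comp_apply, ← h, ← hF]
    rfl
  obtain ⟨y, hy⟩ := QuotientAddGroup.mk_surjective (F 0).2
  obtain ⟨ψ, ⟨-, hψ⟩, -⟩ :=
    (AddCircle.isCoveringMap_coe (1 : ℝ)).existsUnique_continuousMap_lifts
      (⟨fun x => (F x).2, continuous_snd.comp F.continuous⟩ : C(ℝ × ℝ, Circle1)) 0 y hy
  refine ⟨ψ, fun x => ?_⟩
  have h₁ : (ψ x : Circle1) = (F x).2 := congrFun hψ x
  rw [kleinCover, h₁, ← congrFun hτ x, ← hF]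
  rfl

lemma exists_eq_intCast {h : ℝ × ℝ → ℝ} (hc : Continuous h) (hz : ∀ x, ∃ m : ℤ, h x = m) :
    ∃ m : ℤ, ∀ x, h x = m := by
  obtain ⟨m, hm⟩ := hz 0
  have key : ∀ x, (h x : Circle1) = (0 : ℝ) := fun x => by
    rw [circle_coe_eq_iff]
    simpa using hz x
  refine ⟨m, fun x => ?_⟩
  rw [← hm]
  exact (AddCircle.isCoveringMap_coe (1 : ℝ)).const_of_comp hc
    (fun a b => (key a).trans (key b).symm) x 0

lemma sectionZeroFst_coe (t y : ℝ) : sectionZeroFst (t, y) = kleinCover t 0 := rfl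

lemma sectionHalfFst_coe (t y : ℝ) : sectionHalfFst (t, y) = kleinCover t (1 / 2) := rfl

lemma circle_coe_add_one (t : ℝ) : ((t + 1 : ℝ) : Circle1) = t := by
  simpa only [Int.cast_one] using coe_int_add t 1

/-- The product of the unit interval with the universal cover of the torus. -/
def torusCover : C(unitInterval × (ℝ × ℝ), unitInterval × Torus) :=
  ⟨Prod.map id (Prod.map (↑) (↑)), by fun_prop⟩

lemma isQuotientMap_torusCover : Topology.IsQuotientMap torusCover :=
  have h : IsOpenQuotientMap ((↑) : ℝ → Circle1) := QuotientAddGroup.isOpenQuotientMap_mk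
  (IsOpenQuotientMap.id.prodMap (h.prodMap h)).isQuotientMap

/-- A family of lifts with the right equivariance descends to a homotopy over the circle. -/
lemma tkHomotopicOver_of_lift {f g : C(Torus, KleinBottle)} (ψ : C(unitInterval × (ℝ × ℝ), ℝ))
    (h₀ : ∀ t y : ℝ, f (t, y) = kleinCover t (ψ (0, (t, y))))
    (h₁ : ∀ t y : ℝ, g (t, y) = kleinCover t (ψ (1, (t, y))))
    (hy : ∀ s t y, ψ (s, (t, y + 1)) = ψ (s, (t, y)))
    (m : ℤ) (ht : ∀ s t y, ψ (s, (t + 1, y)) + ψ (s, (t, y)) = m) : TKHomotopicOver f g := by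
  have pt : ∀ s y, Function.Periodic (fun t => kleinCover t (ψ (s, (t, y)))) 1 :=
    fun s y t => kleinCover_add_one_eq_iff.2 ⟨m, ht s t y⟩
  have py : ∀ s t, Function.Periodic (fun y => kleinCover t (ψ (s, (t, y)))) 1 :=
    fun s t y => congrArg (kleinCover t) (hy s t y)
  let Φ : C(unitInterval × (ℝ × ℝ), KleinBottle) :=
    ⟨fun p => kleinCover p.2.1 (ψ p),
      continuous_kleinCover.comp ((continuous_fst.comp continuous_snd).prodMk ψ.continuous)⟩
  have hΦ : Function.FactorsThrough Φ torusCover := by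
    rintro ⟨s, t, y⟩ ⟨s', t', y'⟩ h
    simp only [torusCover, ContinuousMap.coe_mk, Prod.map_apply, id_eq, Prod.mk.injEq] at h
    obtain ⟨rfl, h₂, h₃⟩ := h
    obtain ⟨n, hn⟩ := circle_coe_eq_iff.1 h₂
    obtain ⟨k, hk⟩ := circle_coe_eq_iff.1 h₃
    obtain rfl : t = t' + n * 1 := by linarith
    obtain rfl : y = y' + k * 1 := by linarith
    exact ((pt s _).int_mul n t').trans ((py s _).int_mul k y')
  have key : ∀ s (t y : ℝ), isQuotientMap_torusCover.lift Φ hΦ (s, ((t : Circle1), (y : Circle1))) =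
      kleinCover t (ψ (s, (t, y))) := fun s t y =>
    DFunLike.congr_fun (isQuotientMap_torusCover.lift_comp Φ hΦ) (s, (t, y))
  refine ⟨⟨isQuotientMap_torusCover.lift Φ hΦ, ?_, ?_⟩, ?_⟩
  · rintro ⟨⟨t⟩, ⟨y⟩⟩
    exact (key 0 t y).trans (h₀ t y).symm
  · rintro ⟨⟨t⟩, ⟨y⟩⟩
    exact (key 1 t y).trans (h₁ t y).symm
  · rintro s ⟨⟨t⟩, ⟨y⟩⟩
    exact (congrArg pK (key s t y)).trans (pK_kleinCover _ _)

lemma tkHomotopicOver_iff {f g : C(Torus, KleinBottle)} :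
    TKHomotopicOver f g ↔ ContinuousMap.HomotopicWith f g fun h => TKOverCircle h :=
  ⟨fun ⟨H, hH⟩ => ⟨⟨H, fun s x => hH s x⟩⟩, fun ⟨H⟩ => ⟨H.toHomotopy, fun s x => H.prop s x⟩⟩

lemma exists_torus_lift (f : C(Torus, KleinBottle)) (hf : TKOverCircle f) :
    ∃ (ψ : C(ℝ × ℝ, ℝ)) (m : ℤ), (∀ t y : ℝ, f (t, y) = kleinCover t (ψ (t, y))) ∧
      (∀ t y, ψ (t, y + 1) = ψ (t, y)) ∧ ∀ t y, ψ (t + 1, y) + ψ (t, y) = m := by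
  obtain ⟨ψ, hψ⟩ := exists_kleinCover_lift
    (f.comp ⟨fun p => ((p.1 : Circle1), (p.2 : Circle1)), by fun_prop⟩)
    ⟨Prod.fst, continuous_fst⟩ fun x => hf _
  replace hψ : ∀ t y : ℝ, f (t, y) = kleinCover t (ψ (t, y)) := fun t y => hψ (t, y)
  obtain ⟨m, hm⟩ : ∃ m : ℤ, ∀ x : ℝ × ℝ, ψ (x.1 + 1, x.2) + ψ x = m :=
    exists_eq_intCast (by fun_prop) fun ⟨t, y⟩ => kleinCover_add_one_eq_iff.1
      (by rw [← hψ, ← hψ, circle_coe_add_one])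
  obtain ⟨d, hd⟩ : ∃ d : ℤ, ∀ x : ℝ × ℝ, ψ (x.1, x.2 + 1) - ψ x = d :=
    exists_eq_intCast (by fun_prop) fun ⟨t, y⟩ => kleinCover_eq_iff.1
      (by rw [← hψ, ← hψ, circle_coe_add_one])
  refine ⟨ψ, m, hψ, fun t y => ?_, fun t y => hm (t, y)⟩
  have e₁ := hm (t, y)
  have e₂ := hm (t, y + 1)
  have e₃ := hd (t, y)
  have e₄ := hd (t + 1, y)
  simp only at e₁ e₂ e₃ e₄
  linarith

lemma tkHomotopicOver_section (f : C(Torus, KleinBottle)) (hf : TKOverCircle f) :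
    TKHomotopicOver f sectionZeroFst ∨ TKHomotopicOver f sectionHalfFst := by
  obtain ⟨ψ, m, hψ, hy, ht⟩ := exists_torus_lift f hf
  have key : ∀ g : C(Torus, KleinBottle), (∀ t y : ℝ, g (t, y) = kleinCover t (m / 2)) →
      TKHomotopicOver f g := by
    intro g hg
    refine tkHomotopicOver_of_lift
      ⟨fun p => (1 - (p.1 : ℝ)) * ψ p.2 + p.1 * (m / 2), by fun_prop⟩
      (fun t y => ?_) (fun t y => ?_) (fun s t y => ?_) m (fun s t y => ?_)
    · simp [hψ]
    · simp [hg]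
    · simp [hy]
    · simp only [ContinuousMap.coe_mk]
      linear_combination (1 - (s : ℝ)) * ht t y
  rcases Int.even_or_odd' m with ⟨k, rfl | rfl⟩
  · refine Or.inl (key _ fun t y => ?_)
    rw [sectionZeroFst_coe]
    exact kleinCover_eq_iff.2 ⟨-k, by push_cast; ring⟩
  · refine Or.inr (key _ fun t y => ?_)
    rw [sectionHalfFst_coe]
    exact kleinCover_eq_iff.2 ⟨-k, by push_cast; ring⟩

lemma not_tkHomotopicOver_sections : ¬ TKHomotopicOver sectionZeroFst sectionHalfFst := by
  rintro ⟨H, hH⟩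
  obtain ⟨ψ, hψ⟩ := exists_kleinCover_lift
    ((H : C(unitInterval × Torus, KleinBottle)).comp
      ⟨fun p => (Set.projIcc 0 1 zero_le_one p.1, ((p.2 : Circle1), ((0 : ℝ) : Circle1))), by
        fun_prop⟩)
    ⟨Prod.snd, continuous_snd⟩ fun x => hH _ _
  replace hψ : ∀ s t : ℝ, H (Set.projIcc 0 1 zero_le_one s, ((t : Circle1), ((0 : ℝ) : Circle1))) =
    kleinCover t (ψ (s, t)) := fun s t => hψ (s, t)
  obtain ⟨m, hm⟩ : ∃ m : ℤ, ∀ x : ℝ × ℝ, ψ (x.1, x.2 + 1) + ψ x = m :=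
    exists_eq_intCast (by fun_prop) fun ⟨s, t⟩ => kleinCover_add_one_eq_iff.1
      (by rw [← hψ, ← hψ, circle_coe_add_one])
  obtain ⟨k, hk⟩ : ∃ k : ℤ, ∀ x : ℝ × ℝ, ψ (0, x.2) - 0 = k :=
    exists_eq_intCast (by fun_prop) fun ⟨s, t⟩ => (kleinCover_eq_iff (t := t)).1
      (by rw [← hψ, Set.projIcc_left, ← sectionZeroFst_coe t 0]; exact H.apply_zero _)
  obtain ⟨l, hl⟩ : ∃ l : ℤ, ∀ x : ℝ × ℝ, ψ (1, x.2) - 1 / 2 = l :=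
    exists_eq_intCast (by fun_prop) fun ⟨s, t⟩ => (kleinCover_eq_iff (t := t)).1
      (by rw [← hψ, Set.projIcc_right, ← sectionHalfFst_coe t 0]; exact H.apply_one _)
  have e₀ := hm (0, 0)
  have e₁ := hm (1, 0)
  have k₀ := hk (0, 0)
  have k₁ := hk (0, 1)
  have l₀ := hl (0, 0)
  have l₁ := hl (0, 1)
  simp only [zero_add] at e₀ e₁ k₀ k₁ l₀ l₁
  have h : (2 * k : ℝ) = 2 * l + 1 := by
    linear_combination e₀ - e₁ - k₀ - k₁ + l₀ + l₁
  have h' : 2 * k = 2 * l + 1 := by exact_mod_cast h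
  omega

/-- Proposition 1.1 for maps from the torus to the Klein bottle: every map `f : T → K`
over `S¹` is homotopic over `S¹` to exactly one of `s_0 ∘ Prod.fst` and `s_{1/2} ∘ Prod.fst`;
in particular these two maps are not homotopic over `S¹`. -/
theorem torus_to_klein_classification :
    (∀ f : C(Torus, KleinBottle), TKOverCircle f →
      Xor' (TKHomotopicOver f sectionZeroFst) (TKHomotopicOver f sectionHalfFst)) ∧
    ¬ TKHomotopicOver sectionZeroFst sectionHalfFst := by
  refine ⟨fun f hf => ?_, not_tkHomotopicOver_sections⟩
  have h : ¬ (TKHomotopicOver f sectionZeroFst ∧ TKHomotopicOver f sectionHalfFst) := by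
    rintro ⟨h₀, h₁⟩
    rw [tkHomotopicOver_iff] at h₀ h₁
    exact not_tkHomotopicOver_sections (tkHomotopicOver_iff.2 (h₀.symm.trans h₁))
  exact (xor_iff_or_and_not_and _ _).2 ⟨tkHomotopicOver_section f hf, h⟩
end
end

section
/- For continuous maps f₁, f₂ : T → T over S¹, the pair (f₁, f₂) is loose over S¹ if and only if f₁ is homotopic over S¹ to f₂. (Looseness criterion of Theorem 1.3(i).) -/
noncomputable section

/-- A self-map of the torus is a map over `S¹` if it commutes with the first projection. -/
def TorusOverCircle (f : C(Torus, Torus)) : Prop := ∀ x, (f x).1 = x.1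

/-- A pair of maps over `S¹` is loose over `S¹` if the maps can be deformed over `S¹` to be
coincidence free. -/
def LooseOverCircle (f₁ f₂ : C(Torus, Torus)) : Prop :=
  ∃ f₁' f₂' : C(Torus, Torus), HomotopicOverCircle f₁ f₁' ∧ HomotopicOverCircle f₂ f₂' ∧
    {x : Torus | f₁' x = f₂' x} = ∅

namespace HomotopicOverCircle

theorem symm {f g : C(Torus, Torus)} (h : HomotopicOverCircle f g) :
    HomotopicOverCircle g f := by
  obtain ⟨H, hH⟩ := h
  exact ⟨H.symm, fun s x => by simpa using hH _ x⟩

theorem trans {f g k : C(Torus, Torus)} (h : HomotopicOverCircle f g)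
    (h' : HomotopicOverCircle g k) : HomotopicOverCircle f k := by
  obtain ⟨H, hH⟩ := h
  obtain ⟨K, hK⟩ := h'
  refine ⟨H.trans K, fun s x => ?_⟩
  rw [ContinuousMap.Homotopy.trans_apply]
  split_ifs
  · exact hH _ x
  · exact hK _ x

/-- Maps over the circle whose fibrewise difference lifts to `ℝ` are homotopic over the circle,
by scaling the lift down to zero. -/
theorem of_lift {f g : C(Torus, Torus)} (hf : TorusOverCircle f) (hg : TorusOverCircle g)
    {e : Torus → ℝ} (he : Continuous e) (hfg : ∀ x, (g x).2 = (f x).2 + (e x : Circle1)) :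
    HomotopicOverCircle f g := by
  refine ⟨{ toFun := fun p => (p.2.1, (f p.2).2 + (((p.1 : ℝ) * e p.2 : ℝ) : Circle1))
            continuous_toFun := ?_
            map_zero_left := fun x => ?_
            map_one_left := fun x => ?_ }, fun s x => rfl⟩
  · have hcoe : Continuous ((↑) : ℝ → Circle1) := AddCircle.continuous_mk' 1
    exact continuous_snd.fst.prodMk ((f.continuous.comp continuous_snd).snd.add
      (hcoe.comp ((continuous_subtype_val.comp continuous_fst).mul (he.comp continuous_snd))))
  · exact Prod.ext (hf x).symm (by simp)
  · exact Prod.ext (hg x).symm (by simp [hfg x])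

/-- Coincidence-free maps over the circle are homotopic over the circle. -/
theorem of_forall_ne {f g : C(Torus, Torus)} (hf : TorusOverCircle f) (hg : TorusOverCircle g)
    (hne : ∀ x, f x ≠ g x) : HomotopicOverCircle f g := by
  have hd : ∀ x, (g x).2 - (f x).2 ≠ ((0 : ℝ) : Circle1) := fun x h =>
    hne x (Prod.ext ((hf x).trans (hg x).symm) (sub_eq_zero.mp (by simpa using h)).symm)
  have hc : Continuous fun x => (g x).2 - (f x).2 := by fun_prop
  refine of_lift hf hg (e := fun x => (AddCircle.equivIco (1 : ℝ) 0 ((g x).2 - (f x).2) : ℝ))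
    (continuous_subtype_val.comp ?_) fun x => ?_
  · exact continuous_iff_continuousAt.mpr fun x =>
      ContinuousAt.comp (f := fun x => (g x).2 - (f x).2)
        (AddCircle.continuousAt_equivIco 1 0 (hd x)) hc.continuousAt
  · rw [AddCircle.coe_equivIco, add_sub_cancel]

end HomotopicOverCircle

/-- Translation of a map over the circle by half a turn along the fibres. -/
def torusHalfTurn (f : C(Torus, Torus)) : C(Torus, Torus) where
  toFun x := ((f x).1, (f x).2 + ((1 / 2 : ℝ) : Circle1))
  continuous_toFun := by fun_prop

theorem ne_torusHalfTurn (f : C(Torus, Torus)) (x : Torus) : f x ≠ torusHalfTurn f x := by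
  intro h
  have h2 : ((1 / 2 : ℝ) : Circle1) = 0 := left_eq_add.mp (congrArg Prod.snd h)
  have h3 := (AddCircle.coe_eq_zero_iff_of_mem_Ico (p := (1 : ℝ)) (a := 1 / 2)
    ⟨by norm_num, by norm_num⟩).mp h2
  norm_num at h3

/-- Looseness criterion of Theorem 1.3(i): a pair of self-maps of the torus over `S¹` is
loose over `S¹` if and only if the two maps are homotopic over `S¹`. -/
theorem torus_loose_iff_homotopicOver (f₁ f₂ : C(Torus, Torus))
    (h₁ : TorusOverCircle f₁) (h₂ : TorusOverCircle f₂) :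
    LooseOverCircle f₁ f₂ ↔ HomotopicOverCircle f₁ f₂ := by
  constructor
  · rintro ⟨g₁, g₂, H₁, H₂, hC⟩
    have hg₁ : TorusOverCircle g₁ := fun x => by
      obtain ⟨H, hH⟩ := H₁
      simpa using hH 1 x
    have hg₂ : TorusOverCircle g₂ := fun x => by
      obtain ⟨H, hH⟩ := H₂
      simpa using hH 1 x
    have hne : ∀ x, g₁ x ≠ g₂ x := fun x hx =>
      (Set.eq_empty_iff_forall_notMem.mp hC) x hx
    exact (H₁.trans (.of_forall_ne hg₁ hg₂ hne)).trans H₂.symm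
  · intro h
    exact ⟨f₁, torusHalfTurn f₁, .of_lift h₁ h₁ continuous_const (e := fun _ => 0) (by simp),
      h.symm.trans (.of_forall_ne h₁ h₁ (ne_torusHalfTurn f₁)),
      Set.eq_empty_iff_forall_notMem.mpr (ne_torusHalfTurn f₁)⟩
end
end

section
/- Let f_{q₁,r₁}, f_{q₂,r₂} : T → T be standard torus maps and set q := q₁ − q₂, r := r₁ − r₂. If (q,r) ≠ (0,0), then MCC_B(f_{q₁,r₁}, f_{q₂,r₂}) = gcd(q,r): the minimum over all pairs of maps over S¹ homotopic over S¹ to f_{q₁,r₁} and f_{q₂,r₂} of the number of path components of their coincidence set equals gcd(q,r). (Theorem 1.3(i).) -/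
noncomputable section

open scoped Cardinal

/-- The minimum number `MCC_B(f₁, f₂)` of path components of the coincidence set, over all
pairs of maps homotopic over `S¹` to `f₁` and `f₂` respectively. -/
def MCCTorus (f₁ f₂ : C(Torus, Torus)) : Cardinal :=
  ⨅ p : {p : C(Torus, Torus) × C(Torus, Torus) //
      HomotopicOverCircle f₁ p.1 ∧ HomotopicOverCircle f₂ p.2},
    #(ZerothHomotopy {x : Torus | p.1.1 x = p.1.2 x})

/-- Maps over the circle homotopic to two standard maps differ in the fibre coordinate by a
character plus a real-valued function, and coincide exactly where this difference vanishes. -/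
theorem exists_lift_sub_torusStdMap {q₁ r₁ q₂ r₂ : ℤ} {f₁ f₂ : C(Torus, Torus)}
    (h₁ : HomotopicOverCircle (torusStdMap q₁ r₁) f₁)
    (h₂ : HomotopicOverCircle (torusStdMap q₂ r₂) f₂) :
    ∃ φ : C(Torus, ℝ), ∀ x, f₁ x = f₂ x ↔
      (r₁ - r₂) • x.1 + (q₁ - q₂) • x.2 + (φ x : Circle1) = 0 := by
  obtain ⟨H₁, hH₁⟩ := h₁
  obtain ⟨H₂, hH₂⟩ := h₂
  let D : C(unitInterval × Torus, Circle1) :=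
    ⟨fun y => (H₁ y).2 - (H₂ y).2 - ((r₁ - r₂) • y.2.1 + (q₁ - q₂) • y.2.2), by fun_prop⟩
  have hD : ∀ x, D (0, x) = ((ContinuousMap.const Torus (0 : ℝ) x : ℝ) : Circle1) := by
    intro x
    simp only [D, ContinuousMap.coe_mk]
    rw [H₁.apply_zero, H₂.apply_zero]
    simp only [torusStdMap, ContinuousMap.coe_mk, ContinuousMap.const_apply,
      AddCircle.coe_zero, sub_smul]
    abel
  let L := (AddCircle.isCoveringMap_coe (1 : ℝ)).liftHomotopy D _ hD
  have hL : ∀ y, ((L y : ℝ) : Circle1) = D y := fun y =>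
    congrFun ((AddCircle.isCoveringMap_coe (1 : ℝ)).liftHomotopy_lifts D _ hD) y
  refine ⟨⟨fun x => L (1, x), by fun_prop⟩, fun x => ?_⟩
  have e₁ : (f₁ x).1 = x.1 := by simpa using hH₁ 1 x
  have e₂ : (f₂ x).1 = x.1 := by simpa using hH₂ 1 x
  simp only [ContinuousMap.coe_mk, hL, D, ContinuousMap.Homotopy.apply_one, add_sub_cancel,
    sub_eq_zero]
  exact ⟨fun h => by rw [h], fun h => Prod.ext (e₁.trans e₂.symm) h⟩

/-- A real perturbation of a primitive character of the torus is surjective. -/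
theorem surjective_primitive_character_add {q r a b : ℤ} (hab : r * a + q * b = 1)
    (φ : C(Torus, ℝ)) :
    Function.Surjective fun x : Torus => r • x.1 + q • x.2 + (φ x : Circle1) := by
  intro c
  let γ : ℝ → Torus := fun s => (a • (s : Circle1), b • (s : Circle1))
  have hγ : Continuous γ := by
    have := AddCircle.continuous_mk' (1 : ℝ)
    fun_prop
  have hγ₁ : γ 1 = γ 0 := by
    simp only [γ, AddCircle.coe_period, AddCircle.coe_zero]
  let F : ℝ → ℝ := fun s => s + φ (γ s)
  obtain ⟨y, hy, rfl⟩ : ∃ y : ℝ, y ∈ Set.Ico (F 0) (F 0 + 1) ∧ (y : Circle1) = c := by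
    exact (AddCircle.coe_image_Ico_eq (1 : ℝ) (F 0)).ge (Set.mem_univ c)
  have hF₁ : F 1 = F 0 + 1 := by simp only [F, hγ₁]; ring
  obtain ⟨s, -, hs⟩ := intermediate_value_Icc (zero_le_one' ℝ)
    (f := F) (by fun_prop) ⟨hy.1, hF₁ ▸ hy.2.le⟩
  refine ⟨γ s, ?_⟩
  have key : r • a • (s : Circle1) + q • b • (s : Circle1) = s := by
    rw [smul_smul, smul_smul, ← add_smul, hab, one_smul]
  simp only [← hs, F, AddCircle.coe_add, γ, key]

theorem finite_setOf_nsmul_eq_zero {g : ℕ} (hg : 0 < g) :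
    {c : Circle1 | g • c = 0}.Finite := by
  refine ((Set.finite_Iio g).image fun m : ℕ => ((m / g * 1 : ℝ) : Circle1)).subset ?_
  intro c hc
  exact (AddCircle.nsmul_eq_zero_iff hg).1 hc

theorem injective_coe_div {g : ℕ} (hg : 0 < g) :
    Function.Injective fun k : Fin g => ((k / g : ℝ) : Circle1) := by
  have hg' : (0 : ℝ) < g := by exact_mod_cast hg
  have mem : ∀ k : Fin g, (k / g : ℝ) ∈ Set.Ico (0 : ℝ) (0 + 1) := fun k =>
    ⟨by positivity, by
      rw [zero_add, div_lt_one hg']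
      exact_mod_cast k.2⟩
  intro k l hkl
  have := (AddCircle.coe_eq_coe_iff_of_mem_Ico (mem k) (mem l)).1 hkl
  rw [div_left_inj' hg'.ne'] at this
  exact Fin.ext (by exact_mod_cast this)

/-- A continuous map to the circle all of whose values are `g`-torsion points agrees on points
joined by a path. -/
theorem Joined.eq_of_nsmul_eq_zero {X : Type*} [TopologicalSpace X] {g : ℕ} (hg : 0 < g)
    {ψ : X → Circle1} (hψ : Continuous ψ) (h₀ : ∀ x, g • ψ x = 0) {x y : X} (h : Joined x y) :
    ψ x = ψ y := by
  obtain ⟨γ⟩ := h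
  have hpre : IsPreconnected (Set.range (ψ ∘ γ)) :=
    isPreconnected_range (hψ.comp γ.continuous)
  have hfin : (Set.range (ψ ∘ γ)).Finite :=
    (finite_setOf_nsmul_eq_zero hg).subset (Set.range_subset_iff.2 fun t => h₀ _)
  have hsub : (Set.range (ψ ∘ γ)).Subsingleton := by
    by_contra hn
    exact hpre.infinite_of_nontrivial (Set.not_subsingleton_iff.1 hn) hfin
  exact hsub ⟨0, by simp⟩ ⟨1, by simp⟩

theorem le_mk_zerothHomotopy_character_add {q r a b : ℤ} (hab : r * a + q * b = 1) {g : ℕ}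
    (hg : 0 < g) (φ : C(Torus, ℝ)) :
    (g : Cardinal) ≤
      #(ZerothHomotopy {x : Torus | g • (r • x.1 + q • x.2) + (φ x : Circle1) = 0}) := by
  have hg' : (g : ℝ) ≠ 0 := by exact_mod_cast hg.ne'
  let φ' : C(Torus, ℝ) := ⟨fun x => φ x / g, by fun_prop⟩
  let ψ : Torus → Circle1 := fun x => r • x.1 + q • x.2 + (φ' x : Circle1)
  have hψ : Continuous ψ := by
    have := (AddCircle.continuous_mk' (1 : ℝ)).comp φ'.continuous
    exact (by fun_prop : Continuous fun x : Torus => r • x.1 + q • x.2).add this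
  have hψg : ∀ x, g • ψ x = g • (r • x.1 + q • x.2) + (φ x : Circle1) := fun x => by
    rw [smul_add, ← AddCircle.coe_nsmul]
    simp only [φ', ContinuousMap.coe_mk, nsmul_eq_mul, mul_div_cancel₀ _ hg']
  choose p hp using fun k : Fin g =>
    surjective_primitive_character_add hab φ' ((k / g : ℝ) : Circle1)
  have hp₀ : ∀ k, g • (r • (p k).1 + q • (p k).2) + (φ (p k) : Circle1) = 0 := fun k => by
    rw [← hψg]
    refine (AddCircle.nsmul_eq_zero_iff hg).2 ⟨k, k.2, ?_⟩
    rw [mul_one]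
    exact (hp k).symm
  rw [← Cardinal.mk_fin]
  refine Cardinal.mk_le_of_injective (f := fun k => ZerothHomotopy.mk ⟨p k, hp₀ k⟩) ?_
  intro k l hkl
  have hj : Joined (⟨p k, hp₀ k⟩ :
      {x : Torus | g • (r • x.1 + q • x.2) + (φ x : Circle1) = 0}) ⟨p l, hp₀ l⟩ :=
    Quotient.exact hkl
  have := hj.eq_of_nsmul_eq_zero hg (hψ.comp continuous_subtype_val)
    fun x => (hψg x.1).trans x.2
  exact injective_coe_div hg ((hp k).symm.trans (this.trans (hp l)))

theorem mk_zerothHomotopy_character_le {q r a b : ℤ} (hab : r * a + q * b = 1) {g : ℕ}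
    (hg : 0 < g) :
    #(ZerothHomotopy {x : Torus | g • (r • x.1 + q • x.2) = 0}) ≤ (g : Cardinal) := by
  let pt : Circle1 → Circle1 → Torus := fun c s => (a • c + q • s, b • c - r • s)
  have hpt : ∀ c s, r • (pt c s).1 + q • (pt c s).2 = c := fun c s => by
    calc _ = (r * a + q * b) • c := by simp only [pt]; module
      _ = c := by rw [hab, one_smul]
  have hpt' : ∀ x : Torus, pt (r • x.1 + q • x.2) (b • x.1 - a • x.2) = x := fun x => by
    refine Prod.ext ?_ ?_
    · calc _ = (r * a + q * b) • x.1 := by simp only [pt]; module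
        _ = x.1 := by rw [hab, one_smul]
    · calc _ = (r * a + q * b) • x.2 := by simp only [pt]; module
        _ = x.2 := by rw [hab, one_smul]
  let c : Fin g → Circle1 := fun k => ((k / g * 1 : ℝ) : Circle1)
  have hc : ∀ k, g • c k = 0 := fun k => (AddCircle.nsmul_eq_zero_iff hg).2 ⟨k, k.2, rfl⟩
  rw [← Cardinal.mk_fin]
  refine Cardinal.mk_le_of_surjective
    (f := fun k => ZerothHomotopy.mk ⟨pt (c k) 0, by simp only [Set.mem_ofPred_eq, hpt, hc]⟩) ?_
  refine ZerothHomotopy.rec fun x => ?_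
  obtain ⟨m, hm, hmx⟩ := (AddCircle.nsmul_eq_zero_iff hg).1 x.2
  refine ⟨⟨m, hm⟩, Quotient.sound ?_⟩
  let e : Circle1 → {x : Torus | g • (r • x.1 + q • x.2) = 0} := fun s =>
    ⟨pt (c ⟨m, hm⟩) s, by simp only [Set.mem_ofPred_eq, hpt, hc]⟩
  have he : Continuous e := by
    refine Continuous.subtype_mk ?_ _
    simp only [pt]
    fun_prop
  have hx : e (b • x.1.1 - a • x.1.2) = x := Subtype.ext <| by
    simp only [e, c, hmx, hpt']
  have hj := (PathConnectedSpace.joined (0 : Circle1) (b • x.1.1 - a • x.1.2)).map he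
  rwa [hx] at hj

/-- Theorem 1.3(i): for standard torus maps with `(q, r) := (q₁ - q₂, r₁ - r₂) ≠ (0, 0)`,
the minimum number of coincidence components over `S¹` equals `gcd(q, r)`. -/
theorem torus_MCC_eq_gcd (q₁ r₁ q₂ r₂ : ℤ)
    (h : (q₁ - q₂, r₁ - r₂) ≠ (0, 0)) :
    MCCTorus (torusStdMap q₁ r₁) (torusStdMap q₂ r₂) =
      (Int.gcd (q₁ - q₂) (r₁ - r₂) : Cardinal) := by
  have hg : 0 < Int.gcd (q₁ - q₂) (r₁ - r₂) := by
    rw [Int.gcd_pos_iff]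
    by_contra! hn
    exact h (Prod.ext hn.1 hn.2)
  have hbez := Int.gcd_eq_gcd_ab (q₁ - q₂) (r₁ - r₂)
  obtain ⟨q, hq⟩ : (Int.gcd (q₁ - q₂) (r₁ - r₂) : ℤ) ∣ q₁ - q₂ := Int.gcd_dvd_left ..
  obtain ⟨r, hr⟩ : (Int.gcd (q₁ - q₂) (r₁ - r₂) : ℤ) ∣ r₁ - r₂ := Int.gcd_dvd_right ..
  generalize Int.gcdA (q₁ - q₂) (r₁ - r₂) = b at hbez
  generalize Int.gcdB (q₁ - q₂) (r₁ - r₂) = a at hbez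
  generalize Int.gcd (q₁ - q₂) (r₁ - r₂) = g at *
  have hab : r * a + q * b = 1 := by
    refine mul_left_cancel₀ (show (g : ℤ) ≠ 0 by exact_mod_cast hg.ne') ?_
    rw [hq, hr] at hbez
    linarith
  have hchar : ∀ x : Torus,
      (r₁ - r₂) • x.1 + (q₁ - q₂) • x.2 = g • (r • x.1 + q • x.2) := fun x => by
    rw [hq, hr, smul_add, mul_smul, mul_smul, natCast_zsmul, natCast_zsmul]
  have hrefl : ∀ f : C(Torus, Torus), (∀ x, (f x).1 = x.1) → HomotopicOverCircle f f :=
    fun f hf => ⟨.refl f, fun _ x => hf x⟩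
  let std : {p : C(Torus, Torus) × C(Torus, Torus) //
      HomotopicOverCircle (torusStdMap q₁ r₁) p.1 ∧
        HomotopicOverCircle (torusStdMap q₂ r₂) p.2} :=
    ⟨(torusStdMap q₁ r₁, torusStdMap q₂ r₂), hrefl _ fun _ => rfl, hrefl _ fun _ => rfl⟩
  have := Nonempty.intro std
  refine le_antisymm ((ciInf_le' _ std).trans ?_) (le_ciInf fun p => ?_)
  · have hset : {x : Torus | std.1.1 x = std.1.2 x} =
        {x : Torus | g • (r • x.1 + q • x.2) = 0} := by
      ext x
      rw [Set.mem_ofPred_eq, Set.mem_ofPred_eq, ← hchar]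
      simp only [std, torusStdMap, ContinuousMap.coe_mk, Prod.mk.injEq, true_and]
      rw [← sub_eq_zero, sub_smul, sub_smul]
      exact iff_of_eq (congrArg (· = 0) (by abel))
    rw [hset]
    exact mk_zerothHomotopy_character_le hab hg
  · obtain ⟨φ, hφ⟩ := exists_lift_sub_torusStdMap p.2.1 p.2.2
    have hset : {x : Torus | p.1.1 x = p.1.2 x} =
        {x : Torus | g • (r • x.1 + q • x.2) + (φ x : Circle1) = 0} := by
      ext x
      rw [Set.mem_ofPred_eq, Set.mem_ofPred_eq, hφ, hchar]
    rw [hset]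
    exact le_mk_zerothHomotopy_character_add hab hg φ
end
end

section
/- For integers q, r with (q,r) ≠ (0,0), the subset {(t,z) ∈ AddCircle 1 × AddCircle 1 | r • t + q • z = 0} of the torus has exactly gcd(q,r) path components. (Computation of the coincidence set of standard torus maps, used in the proofs of Theorems 1.3 and 1.4.) -/
noncomputable section

open scoped Cardinal

/-- A continuous surjection onto a totally disconnected space whose fibres are path connected
identifies the set of path components of its source with its target. -/
def zerothHomotopyEquivOfJoinedFibers {X T : Type*} [TopologicalSpace X]
    [TopologicalSpace T] [TotallyDisconnectedSpace T] (f : X → T) (hf : Continuous f)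
    (hsurj : Function.Surjective f) (hjoined : ∀ x y, f x = f y → Joined x y) :
    ZerothHomotopy X ≃ T :=
  Equiv.ofBijective
    (ZerothHomotopy.lift f fun x y p => by
      simpa using (isPreconnected_range (hf.comp p.continuous)).subsingleton
        (Set.mem_range_self 0) (Set.mem_range_self 1))
    ⟨fun a b => by
      induction a using ZerothHomotopy.rec with | mk x
      induction b using ZerothHomotopy.rec with | mk y
      intro h
      exact ZerothHomotopy.sound (hjoined x y h).somePath,
    fun t => by
      obtain ⟨x, rfl⟩ := hsurj t
      exact ⟨.mk x, rfl⟩⟩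

/-- The circle has exactly `d` points of order dividing `d`. -/
theorem AddCircle.natCard_torsion (p : ℝ) [Fact (0 < p)] {d : ℕ} (hd : 0 < d) :
    Nat.card {w : AddCircle p | d • w = 0} = d := by
  have h : {w : AddCircle p | d • w = 0} =
      (AddSubgroup.zmultiples ((p / d : ℝ) : AddCircle p) : Set (AddCircle p)) := by
    ext w
    constructor
    · intro hw
      obtain ⟨m, -, rfl⟩ := (AddCircle.nsmul_eq_zero_iff hd).1 hw
      rw [AddCircle.natCast_div_mul_eq_nsmul]
      exact AddSubgroup.nsmul_mem _ (AddSubgroup.mem_zmultiples _) m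
    · rintro ⟨k, rfl⟩
      have h0 : d • ((p / d : ℝ) : AddCircle p) = 0 := by
        simpa only [AddCircle.addOrderOf_period_div hd] using
          addOrderOf_nsmul_eq_zero ((p / d : ℝ) : AddCircle p)
      change d • (k • ((p / d : ℝ) : AddCircle p)) = 0
      rw [smul_comm, h0, smul_zero]
  rw [h]
  exact (Nat.card_zmultiples _).trans (AddCircle.addOrderOf_period_div hd)

/-- For integers `(q, r) ≠ (0, 0)`, the subset `{(t, z) | r • t + q • z = 0}` of the torus
has exactly `gcd(q, r)` path components. -/
theorem torus_coincidence_components (q r : ℤ) (h : (q, r) ≠ (0, 0)) :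
    #(ZerothHomotopy {x : Torus | r • x.1 + q • x.2 = 0}) = (Int.gcd q r : Cardinal) := by
  have hd : 0 < Int.gcd q r := Int.gcd_pos_iff.2 (by
    by_contra! hqr
    exact h (Prod.ext hqr.1 hqr.2))
  obtain ⟨a, ha⟩ := Int.gcd_dvd_left q r
  obtain ⟨b, hb⟩ := Int.gcd_dvd_right q r
  have hbez := Int.gcd_eq_gcd_ab q r
  generalize Int.gcdA q r = u at hbez
  generalize Int.gcdB q r = v at hbez
  generalize Int.gcd q r = d at *
  subst ha hb
  have huv : a * u + b * v = 1 := by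
    have : (d : ℤ) ≠ 0 := by exact_mod_cast hd.ne'
    apply mul_left_cancel₀ this
    linarith
  let T : Set Circle1 := {w | d • w = 0}
  have : Finite T := AddCircle.finite_torsion 1 hd
  let f : {x : Torus | ((d : ℤ) * b) • x.1 + ((d : ℤ) * a) • x.2 = 0} → T := fun x =>
    ⟨b • x.1.1 + a • x.1.2, by
      change d • (b • x.1.1 + a • x.1.2) = 0
      rw [← natCast_zsmul, smul_add, ← mul_smul, ← mul_smul]
      exact x.2⟩
  have hf : Continuous f := by fun_prop
  -- `(w, s) ↦ (v • w + a • s, u • w - b • s)` parametrizes the coincidence set.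
  let g : T → Circle1 → {x : Torus | ((d : ℤ) * b) • x.1 + ((d : ℤ) * a) • x.2 = 0} := fun w s =>
    ⟨(v • w.1 + a • s, u • w.1 - b • s), by
      have hw : (d : ℤ) • w.1 = 0 := (natCast_zsmul _ _).trans w.2
      change ((d : ℤ) * b) • (v • w.1 + a • s) + ((d : ℤ) * a) • (u • w.1 - b • s) = 0
      calc _ = (a * u + b * v) • ((d : ℤ) • w.1) := by module
        _ = 0 := by rw [hw, smul_zero]⟩
  have hg (w : T) : Continuous (g w) := by fun_prop
  have hfg (w : T) (s : Circle1) : f (g w s) = w := by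
    apply Subtype.ext
    change b • (v • w.1 + a • s) + a • (u • w.1 - b • s) = w.1
    calc _ = (a * u + b * v) • w.1 := by module
      _ = w.1 := by rw [huv, one_smul]
  have hgf (x) : g (f x) (u • x.1.1 - v • x.1.2) = x := by
    refine Subtype.ext (Prod.ext ?_ ?_)
    · change v • (b • x.1.1 + a • x.1.2) + a • (u • x.1.1 - v • x.1.2) = x.1.1
      calc _ = (a * u + b * v) • x.1.1 := by module
        _ = x.1.1 := by rw [huv, one_smul]
    · change u • (b • x.1.1 + a • x.1.2) - b • (u • x.1.1 - v • x.1.2) = x.1.2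
      calc _ = (a * u + b * v) • x.1.2 := by module
        _ = x.1.2 := by rw [huv, one_smul]
  have e := zerothHomotopyEquivOfJoinedFibers f hf (fun w => ⟨g w 0, hfg w 0⟩) fun x y hxy => by
    rw [← hgf x, ← hgf y, hxy]
    exact (PathConnectedSpace.joined _ _).map (hg _)
  rw [Cardinal.mk_congr e, ← Nat.cast_card, AddCircle.natCard_torsion 1 hd]
end
end

section
/- Let g_{q₁,r₁}, g_{q₂,r₂} : K → K be standard Klein bottle maps and set q := q₁ − q₂ and r := (r₁ − r₂) mod 2. If q ≠ 0, then MCC_B(g_{q₁,r₁}, g_{q₂,r₂}) equals |q|/2 when q is even and r = 1, and equals ⌊|q|/2⌋ + 1 otherwise. (Minimum coincidence component count of Theorem 1.3(ii) for q ≠ 0.) -/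
noncomputable section

open scoped Cardinal

/-- The minimum number `MCC_B(f₁, f₂)` of path components of the coincidence set, over all
pairs of maps homotopic over `S¹` to `f₁` and `f₂` respectively. -/
def MCCKlein (f₁ f₂ : C(KleinBottle, KleinBottle)) : Cardinal :=
  ⨅ p : {p : C(KleinBottle, KleinBottle) × C(KleinBottle, KleinBottle) //
      KleinHomotopicOver f₁ p.1 ∧ KleinHomotopicOver f₂ p.2},
    #(ZerothHomotopy {x : KleinBottle | p.1.1 x = p.1.2 x})

lemma kleinBottle_mk_add_one_neg (t : ℝ) (z : Circle1) :
    Quot.mk kleinRel (t + 1, -z) = Quot.mk kleinRel (t, z) :=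
  (Quot.sound ⟨1, by simp⟩).symm

/-- A function on `ℝ × S¹` invariant under `(t, z) ↦ (t + 1, -z)` respects `kleinRel`. -/
lemma eq_of_kleinRel {α : Type*} {f : ℝ × Circle1 → α}
    (hf : ∀ t z, f (t + 1, -z) = f (t, z)) {a b : ℝ × Circle1} (h : kleinRel a b) :
    f a = f b := by
  obtain ⟨n, rfl⟩ := h
  obtain ⟨t, z⟩ := a
  induction n using Int.induction_on with
  | zero => simp
  | succ i ih =>
    rw [ih, ← hf]
    simp [zpow_add, add_assoc]
  | pred i ih =>
    rw [ih, ← hf (t + ((-(i : ℤ) - 1 : ℤ) : ℝ))]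
    congr 2
    · push_cast; ring
    · simp [zpow_sub]

/-- Recovering the fibre coordinate: a continuous function on `ℝ × K` whose restriction to pairs
`(t, [t, w])` is the unit complex number determined by `w`. -/
lemma exists_continuous_fibre_coordinate :
    ∃ R : ℝ × KleinBottle → ℂ, Continuous R ∧
      ∀ t w, R (t, Quot.mk kleinRel (t, w)) = (AddCircle.toCircle w : ℂ) := by
  have hre : ∀ (_ : ℝ) (z : Circle1), ((AddCircle.toCircle (-z) : Circle) : ℂ).re =
      ((AddCircle.toCircle z : Circle) : ℂ).re := fun _ z => by
    simp [AddCircle.toCircle_neg]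
  have him : ∀ z : Circle1, ((AddCircle.toCircle (-z) : Circle) : ℂ).im =
      -((AddCircle.toCircle z : Circle) : ℂ).im := fun z => by
    simp [AddCircle.toCircle_neg]
  have hcont : Continuous fun a : ℝ × Circle1 => ((AddCircle.toCircle a.2 : Circle) : ℂ) :=
    continuous_subtype_val.comp (AddCircle.continuous_toCircle.comp continuous_snd)
  have hcos : ∀ t : ℝ, Real.cos (Real.pi * (t + 1)) = -Real.cos (Real.pi * t) := fun t => by
    rw [mul_add, mul_one, Real.cos_add_pi]
  have hsin : ∀ t : ℝ, Real.sin (Real.pi * (t + 1)) = -Real.sin (Real.pi * t) := fun t => by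
    rw [mul_add, mul_one, Real.sin_add_pi]
  let c : KleinBottle → ℝ := Quot.lift (fun a => ((AddCircle.toCircle a.2 : Circle) : ℂ).re)
    fun _ _ => eq_of_kleinRel (f := fun a => ((AddCircle.toCircle a.2 : Circle) : ℂ).re) hre
  let a : KleinBottle → ℝ := Quot.lift
    (fun a => ((AddCircle.toCircle a.2 : Circle) : ℂ).im * Real.cos (Real.pi * a.1))
    fun _ _ => eq_of_kleinRel
      (f := fun a => ((AddCircle.toCircle a.2 : Circle) : ℂ).im * Real.cos (Real.pi * a.1))
      fun t z => by simp only [him, hcos, neg_mul_neg]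
  let b : KleinBottle → ℝ := Quot.lift
    (fun a => ((AddCircle.toCircle a.2 : Circle) : ℂ).im * Real.sin (Real.pi * a.1))
    fun _ _ => eq_of_kleinRel
      (f := fun a => ((AddCircle.toCircle a.2 : Circle) : ℂ).im * Real.sin (Real.pi * a.1))
      fun t z => by simp only [him, hsin, neg_mul_neg]
  have hc : Continuous c := continuous_quot_lift _ (Complex.continuous_re.comp hcont)
  have ha : Continuous a := continuous_quot_lift _
    ((Complex.continuous_im.comp hcont).mul (by fun_prop))
  have hb : Continuous b := continuous_quot_lift _
    ((Complex.continuous_im.comp hcont).mul (by fun_prop))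
  refine ⟨fun x => c x.2 + (a x.2 * Real.cos (Real.pi * x.1) +
    b x.2 * Real.sin (Real.pi * x.1) : ℝ) * Complex.I, ?_, fun t w => ?_⟩
  · fun_prop
  · have h : ((AddCircle.toCircle w : Circle) : ℂ).im =
        ((AddCircle.toCircle w : Circle) : ℂ).im * Real.cos (Real.pi * t) * Real.cos (Real.pi * t) +
        ((AddCircle.toCircle w : Circle) : ℂ).im * Real.sin (Real.pi * t) *
          Real.sin (Real.pi * t) := by
      linear_combination (-((AddCircle.toCircle w : Circle) : ℂ).im) *
        Real.cos_sq_add_sin_sq (Real.pi * t)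
    change (((AddCircle.toCircle w : Circle) : ℂ).re : ℂ) + (_ : ℝ) * Complex.I = _
    conv_rhs => rw [← Complex.re_add_im (AddCircle.toCircle w : ℂ), h]

lemma injective_coe_toCircle :
    Function.Injective fun z : Circle1 => (AddCircle.toCircle z : ℂ) :=
  Subtype.val_injective.comp (AddCircle.injective_toCircle one_ne_zero)

lemma isInducing_coe_toCircle :
    Topology.IsInducing fun z : Circle1 => (AddCircle.toCircle z : ℂ) :=
  have : Fact ((0 : ℝ) < 1) := ⟨one_pos⟩
  ((continuous_subtype_val.comp AddCircle.continuous_toCircle).isClosedEmbedding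
    injective_coe_toCircle).isInducing

lemma kleinBottle_mk_right_injective (t : ℝ) :
    Function.Injective fun w : Circle1 => Quot.mk kleinRel (t, w) := by
  obtain ⟨R, -, hR⟩ := exists_continuous_fibre_coordinate
  intro w w' h
  refine injective_coe_toCircle ?_
  simp only [← hR t]
  exact congrArg (fun y => R (t, y)) h

lemma exists_eq_mk_of_pK_eq {t : ℝ} {y : KleinBottle} (h : pK y = (t : Circle1)) :
    ∃ w : Circle1, y = Quot.mk kleinRel (t, w) := by
  obtain ⟨⟨s, z⟩, rfl⟩ := Quot.exists_rep y
  have h' : ((s : ℝ) : Circle1) = (t : Circle1) := h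
  obtain ⟨n, hn⟩ := (AddCircle.coe_eq_zero_iff (1 : ℝ)).1
    (show ((t - s : ℝ) : Circle1) = 0 by rw [AddCircle.coe_sub, h', sub_self])
  refine ⟨_, Quot.sound ⟨n, Prod.ext ?_ rfl⟩⟩
  simp only [zsmul_eq_mul, mul_one] at hn
  simp [hn]

/-- A family of points of `K` lying over a continuous real parameter has a continuous
fibre coordinate. -/
lemma exists_continuous_fibre_lift {X : Type*} [TopologicalSpace X] {u : X → ℝ}
    {h : X → KleinBottle} (hu : Continuous u) (hh : Continuous h)
    (hp : ∀ x, pK (h x) = (u x : Circle1)) :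
    ∃ φ : X → Circle1, Continuous φ ∧ ∀ x, h x = Quot.mk kleinRel (u x, φ x) := by
  obtain ⟨R, hRc, hR⟩ := exists_continuous_fibre_coordinate
  choose φ hφ using fun x => exists_eq_mk_of_pK_eq (hp x)
  refine ⟨φ, isInducing_coe_toCircle.continuous_iff.2 ?_, hφ⟩
  refine (hRc.comp (hu.prodMk hh)).congr fun x => ?_
  simp only [Function.comp_apply, hφ x, hR]

lemma eq_of_continuous_of_countable_range {X : Type*} [TopologicalSpace X] [PreconnectedSpace X]
    {f : X → ℝ} (hf : Continuous f) {S : Set ℝ} (hS : S.Countable) (hfS : ∀ x, f x ∈ S)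
    (x y : X) : f x = f y :=
  hS.isTotallyDisconnected (Set.range f) (Set.range_subset_iff.2 hfS) (isPreconnected_range hf)
    ⟨x, rfl⟩ ⟨y, rfl⟩

lemma coe_eq_zero_iff_exists_int (x : ℝ) : (x : Circle1) = 0 ↔ ∃ k : ℤ, x = k := by
  rw [AddCircle.coe_eq_zero_iff]
  simp [eq_comm]

/-- The difference of fibre coordinates of two maps homotopic over `S¹` to standard maps,
lifted to the universal cover. -/
lemma exists_difference_lift {q₁ q₂ r₁ r₂ : ℤ} {f₁ f₂ : C(KleinBottle, KleinBottle)}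
    (h₁ : KleinHomotopicOver (kleinStdMap q₁ r₁) f₁)
    (h₂ : KleinHomotopicOver (kleinStdMap q₂ r₂) f₂) :
    ∃ D : ℝ × ℝ → ℝ, Continuous D ∧
      (∀ t x, D (t, x + 1) = D (t, x) + (q₁ - q₂ : ℤ)) ∧
      (∀ t x, D (t + 1, -x) = (r₁ - r₂ : ℤ) - D (t, x)) ∧
      ∀ t x : ℝ, f₁ (Quot.mk kleinRel (t, (x : Circle1))) = f₂ (Quot.mk kleinRel (t, x)) ↔
        ∃ k : ℤ, D (t, x) = k := by
  have key : ∀ {q r : ℤ} {f : C(KleinBottle, KleinBottle)},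
      KleinHomotopicOver (kleinStdMap q r) f →
      ∃ φ : unitInterval × (ℝ × ℝ) → Circle1, Continuous φ ∧
        (∀ s t x, φ (s, t, x + 1) = φ (s, t, x)) ∧
        (∀ s t x, φ (s, t + 1, -x) = -φ (s, t, x)) ∧
        (∀ t x, φ (0, t, x) = ((q * x + r * (1 / 2) : ℝ) : Circle1)) ∧
        ∀ t x : ℝ, f (Quot.mk kleinRel (t, (x : Circle1))) =
          Quot.mk kleinRel (t, φ (1, t, x)) := by
    rintro q r f ⟨H, hH⟩
    obtain ⟨φ, hφc, hφ⟩ := exists_continuous_fibre_lift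
      (X := unitInterval × (ℝ × ℝ)) (u := fun a => a.2.1)
      (h := fun a => H (a.1, Quot.mk kleinRel (a.2.1, (a.2.2 : Circle1))))
      (by fun_prop)
      (H.continuous.comp (continuous_fst.prodMk (continuous_quot_mk.comp
        ((continuous_fst.comp continuous_snd).prodMk
          (continuous_quotient_mk'.comp (continuous_snd.comp continuous_snd))))))
      (fun a => hH _ _)
    refine ⟨φ, hφc, fun s t x => ?_, fun s t x => ?_, fun t x => ?_, fun t x => ?_⟩
    · apply kleinBottle_mk_right_injective t
      have h := hφ (s, t, x + 1)
      have h' := hφ (s, t, x)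
      simp only [AddCircle.coe_add_period] at h h'
      exact h.symm.trans h'
    · apply kleinBottle_mk_right_injective (t + 1)
      have h := hφ (s, t + 1, -x)
      have h' := hφ (s, t, x)
      simp only [AddCircle.coe_neg, kleinBottle_mk_add_one_neg] at h h'
      exact (h.symm.trans h').trans (kleinBottle_mk_add_one_neg _ _).symm
    · apply kleinBottle_mk_right_injective t
      have h := hφ (0, t, x)
      simp only [ContinuousMap.Homotopy.apply_zero] at h
      refine h.symm.trans ?_
      change Quot.mk kleinRel (t, q • (x : Circle1) + r • half) = _
      congr 2
      rw [half, ← AddCircle.coe_zsmul, ← AddCircle.coe_zsmul, ← AddCircle.coe_add]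
      simp
    · simpa using hφ (1, t, x)
  obtain ⟨φ₁, hc₁, ht₁, hn₁, h0₁, hf₁⟩ := key h₁
  obtain ⟨φ₂, hc₂, ht₂, hn₂, h0₂, hf₂⟩ := key h₂
  let ψ : C(unitInterval × (ℝ × ℝ), Circle1) := ⟨fun a => φ₁ a - φ₂ a, hc₁.sub hc₂⟩
  let L₀ : C(ℝ × ℝ, ℝ) :=
    ⟨fun a => (q₁ - q₂ : ℤ) * a.2 + (r₁ - r₂ : ℤ) * (1 / 2), by fun_prop⟩
  have hψ0 : ∀ a, ψ (0, a) = ((L₀ a : ℝ) : Circle1) := by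
    rintro ⟨t, x⟩
    change φ₁ _ - φ₂ _ = (((q₁ - q₂ : ℤ) * x + (r₁ - r₂ : ℤ) * (1 / 2) : ℝ) : Circle1)
    rw [h0₁, h0₂, ← AddCircle.coe_sub]
    congr 1
    push_cast
    ring
  have cov := AddCircle.isCoveringMap_coe (1 : ℝ)
  obtain ⟨L, hL, hL0⟩ : ∃ L : C(unitInterval × (ℝ × ℝ), ℝ),
      (∀ a, ((L a : ℝ) : Circle1) = ψ a) ∧ ∀ a, L (0, a) = L₀ a :=
    ⟨cov.liftHomotopy ψ L₀ hψ0, fun a => congrFun (cov.liftHomotopy_lifts ψ L₀ hψ0) a,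
      cov.liftHomotopy_zero ψ L₀ hψ0⟩
  have hint : ∀ {g : unitInterval → ℝ}, Continuous g → (∀ s, (g s : Circle1) = 0) →
      g 1 = g 0 := fun hg h =>
    eq_of_continuous_of_countable_range hg (Set.countable_range ((↑) : ℤ → ℝ))
      (fun s => by
        obtain ⟨k, hk⟩ := (coe_eq_zero_iff_exists_int _).1 (h s)
        exact ⟨k, hk.symm⟩) _ _
  refine ⟨fun a => L (1, a), by fun_prop, fun t x => ?_, fun t x => ?_, fun t x => ?_⟩
  · have h := hint (g := fun s => L (s, t, x + 1) - L (s, t, x)) (by fun_prop) fun s => by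
      rw [AddCircle.coe_sub, hL, hL]
      simp [ψ, ht₁, ht₂]
    simp only [hL0] at h
    simp only [L₀, ContinuousMap.coe_mk] at h
    linear_combination h
  · have h := hint (g := fun s => L (s, t + 1, -x) + L (s, t, x)) (by fun_prop) fun s => by
      rw [AddCircle.coe_add, hL, hL]
      simp only [ψ, ContinuousMap.coe_mk, hn₁, hn₂]
      abel
    simp only [hL0] at h
    simp only [L₀, ContinuousMap.coe_mk] at h
    linear_combination h
  · rw [hf₁, hf₂, (kleinBottle_mk_right_injective t).eq_iff, ← sub_eq_zero,
      ← coe_eq_zero_iff_exists_int, hL]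
    rfl

/-- A continuous function on the plane, invariant under the deck transformations of the universal
cover of `K`, descends to `K`. -/
lemma exists_continuous_descent {θ : ℝ × ℝ → ℝ} (hθ : Continuous θ)
    (h₁ : ∀ t x, θ (t, x + 1) = θ (t, x)) (h₂ : ∀ t x, θ (t + 1, -x) = θ (t, x)) :
    ∃ Θ : KleinBottle → ℝ, Continuous Θ ∧
      ∀ t x : ℝ, Θ (Quot.mk kleinRel (t, (x : Circle1))) = θ (t, x) := by
  have hper : ∀ t, Function.Periodic (fun x => θ (t, x)) 1 := fun t x => h₁ t x
  let η : ℝ × Circle1 → ℝ := fun a => (hper a.1).lift a.2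
  have hη : Continuous η := by
    have hquot : IsOpenQuotientMap
        (Prod.map id (fun x : ℝ => (x : Circle1)) : ℝ × ℝ → ℝ × Circle1) :=
      IsOpenQuotientMap.id.prodMap QuotientAddGroup.isOpenQuotientMap_mk
    exact hquot.continuous_comp_iff.1 hθ
  have hη' : ∀ (t : ℝ) (z : Circle1), η (t + 1, -z) = η (t, z) := by
    rintro t z
    induction z using QuotientAddGroup.induction_on with
    | H x => exact h₂ t x
  exact ⟨Quot.lift η fun _ _ => eq_of_kleinRel hη', continuous_quot_lift _ hη, fun t x => rfl⟩

lemma surjective_of_add_one {g : ℝ → ℝ} (hg : Continuous g) {q : ℤ} (hq : q ≠ 0)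
    (h : ∀ x, g (x + 1) = g x + q) : Function.Surjective g := by
  have hn : ∀ n : ℤ, g n = g 0 + n * q := fun n => by
    induction n using Int.induction_on with
    | zero => simp
    | succ i ih => push_cast at ih ⊢; rw [h, ih]; ring
    | pred i ih =>
      have := h (-(i : ℝ) - 1)
      push_cast at ih ⊢
      rw [sub_add_cancel, ih] at this
      linear_combination -this
  intro y
  obtain ⟨N, hN⟩ := exists_nat_ge |y - g 0|
  have hq' : (1 : ℝ) ≤ q * q := by
    have : 1 ≤ q * q := by nlinarith [mul_self_pos.2 hq]
    exact_mod_cast this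
  obtain ⟨hl, hr⟩ := abs_le.1 hN
  have hN0 : (0 : ℝ) ≤ N := N.cast_nonneg
  have e₁ := hn (N * q)
  have e₂ := hn (-N * q)
  push_cast at e₁ e₂
  refine mem_range_of_exists_le_of_exists_ge hg ⟨_, e₂.le.trans ?_⟩ ⟨_, le_trans ?_ e₁.ge⟩
  · nlinarith
  · nlinarith

/-- Lower bound for the number of path components of the coincidence set. -/
lemma le_mk_zerothHomotopy_coincidence {q₁ q₂ r₁ r₂ : ℤ} {f₁ f₂ : C(KleinBottle, KleinBottle)}
    (h₁ : KleinHomotopicOver (kleinStdMap q₁ r₁) f₁)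
    (h₂ : KleinHomotopicOver (kleinStdMap q₂ r₂) f₂) (hq : q₁ - q₂ ≠ 0) {N : ℕ} {e : ℤ}
    (he : 0 ≤ e) (he2 : (r₁ - r₂) % 2 = e % 2)
    (hN : ∀ j < N, 2 * (j : ℤ) + e ≤ |q₁ - q₂|) :
    (N : Cardinal) ≤ #(ZerothHomotopy {x : KleinBottle | f₁ x = f₂ x}) := by
  obtain ⟨D, hDc, hD1, hD2, hD⟩ := exists_difference_lift h₁ h₂
  set q := q₁ - q₂
  set r := r₁ - r₂
  have hqR : (q : ℝ) ≠ 0 := by exact_mod_cast hq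
  obtain ⟨Θ, hΘc, hΘ⟩ := exists_continuous_descent
    (θ := fun a => Real.cos (Real.pi * (2 * D a - r) / q)) (by fun_prop)
    (fun t x => by
      rw [hD1, ← Real.cos_add_two_pi (Real.pi * (2 * D (t, x) - r) / q)]
      congr 1
      field_simp
      ring)
    (fun t x => by
      rw [hD2, ← Real.cos_neg]
      congr 1
      ring)
  have hΘint : ∀ y : {x : KleinBottle | f₁ x = f₂ x},
      Θ y ∈ Set.range fun k : ℤ => Real.cos (Real.pi * (2 * k - r) / q) := by
    rintro ⟨y, hy⟩
    obtain ⟨⟨t, z⟩, rfl⟩ := Quot.exists_rep y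
    induction z using QuotientAddGroup.induction_on with
    | H x =>
      obtain ⟨k, hk⟩ := (hD t x).1 hy
      exact ⟨k, by simp only [← hk]; exact (hΘ t x).symm⟩
  let Φ : ZerothHomotopy {x : KleinBottle | f₁ x = f₂ x} → ℝ :=
    ZerothHomotopy.lift (fun y => Θ y) fun y y' p => by
      have := eq_of_continuous_of_countable_range
        (f := fun s => Θ (p s)) (by fun_prop) (Set.countable_range _)
        (fun s => hΘint (p s)) 0 1
      simpa using this
  have hsurj := surjective_of_add_one (g := fun x => D (0, x)) (by fun_prop) hq (hD1 0)
  have hx : ∀ j : Fin N, ∃ y, Φ y = Real.cos (Real.pi * (2 * j + e) / |(q : ℝ)|) := fun j => by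
    obtain ⟨d, hd⟩ : ∃ d, r + e = 2 * d := ⟨(r + e) / 2, by omega⟩
    obtain ⟨x, hx⟩ := hsurj (j + d : ℤ)
    refine ⟨.mk ⟨Quot.mk kleinRel (0, (x : Circle1)), (hD 0 x).2 ⟨_, hx⟩⟩, ?_⟩
    have hdR : (r : ℝ) + e = 2 * d := by exact_mod_cast hd
    refine (hΘ 0 x).trans ?_
    simp only at hx ⊢
    have heR : (0 : ℝ) ≤ e := by exact_mod_cast he
    have h : 2 * (((j : ℤ) + d : ℤ) : ℝ) - r = 2 * j + e := by
      push_cast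
      linear_combination -hdR
    rw [hx, h, ← Real.cos_abs, abs_div, abs_of_nonneg (by positivity : 0 ≤ Real.pi * (2 * j + e))]
  choose y hy using hx
  have hyinj : Function.Injective y := by
    intro i j hij
    have h : Real.cos (Real.pi * (2 * i + e) / |(q : ℝ)|) =
      Real.cos (Real.pi * (2 * j + e) / |(q : ℝ)|) := by rw [← hy, ← hy, hij]
    have hmem : ∀ j : Fin N,
        Real.pi * (2 * j + e) / |(q : ℝ)| ∈ Set.Icc 0 Real.pi := fun j => by
      have hj : (2 * j + e : ℝ) ≤ |(q : ℝ)| := by exact_mod_cast hN j j.2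
      have heR : (0 : ℝ) ≤ e := by exact_mod_cast he
      refine ⟨by positivity, ?_⟩
      rw [div_le_iff₀ (abs_pos.2 hqR)]
      gcongr
    have h' := Real.injOn_cos (hmem i) (hmem j) h
    have hq0 := abs_pos.2 hqR
    field_simp at h'
    have : (i : ℝ) = j := by linarith
    exact Fin.ext (by exact_mod_cast this)
  simpa using Cardinal.mk_le_of_injective hyinj

lemma kleinHomotopicOver_kleinStdMap (q r : ℤ) :
    KleinHomotopicOver (kleinStdMap q r) (kleinStdMap q r) := by
  refine ⟨ContinuousMap.Homotopy.refl _, fun s x => ?_⟩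
  obtain ⟨a, rfl⟩ := Quot.exists_rep x
  rfl

lemma kleinStdMap_eq_iff (q₁ q₂ r₁ r₂ : ℤ) (t x : ℝ) :
    kleinStdMap q₁ r₁ (Quot.mk kleinRel (t, (x : Circle1))) =
      kleinStdMap q₂ r₂ (Quot.mk kleinRel (t, x)) ↔
    ∃ k : ℤ, (q₁ - q₂ : ℤ) * (2 * x) + (r₁ - r₂ : ℤ) = 2 * (k : ℝ) := by
  change Quot.mk kleinRel (t, q₁ • (x : Circle1) + r₁ • half) =
    Quot.mk kleinRel (t, q₂ • (x : Circle1) + r₂ • half) ↔ _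
  rw [(kleinBottle_mk_right_injective t).eq_iff, ← sub_eq_zero, half]
  simp only [← AddCircle.coe_zsmul, ← AddCircle.coe_add, ← AddCircle.coe_sub]
  rw [coe_eq_zero_iff_exists_int]
  refine exists_congr fun k => ?_
  push_cast [zsmul_eq_mul]
  constructor <;> intro h <;> linarith

/-- Every point of `K` can be written `[t, x]` with `0 ≤ x ≤ 1 / 2`. -/
lemma exists_kleinBottle_rep (y : KleinBottle) :
    ∃ t x : ℝ, 0 ≤ x ∧ x ≤ 1 / 2 ∧ y = Quot.mk kleinRel (t, (x : Circle1)) := by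
  obtain ⟨⟨t, z⟩, rfl⟩ := Quot.exists_rep y
  induction z using QuotientAddGroup.induction_on with
  | H x =>
    have hx : ((x - round x : ℝ) : Circle1) = x := by
      have := coe_int_add x (-round x)
      rwa [Int.cast_neg, ← sub_eq_add_neg] at this
    have hle := abs_sub_round x
    rcases abs_cases (x - round x) with ⟨h, h0⟩ | ⟨h, h0⟩
    · exact ⟨t, x - round x, h0, h ▸ hle, by rw [hx]⟩
    · refine ⟨t + 1, -(x - round x), by linarith, h ▸ hle, ?_⟩
      rw [AddCircle.coe_neg, kleinBottle_mk_add_one_neg, hx]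

/-- Upper bound for the number of path components of the coincidence set of two
standard maps. -/
lemma mk_zerothHomotopy_kleinStdMap_le {q₁ q₂ r₁ r₂ : ℤ} (hq : q₁ - q₂ ≠ 0) {N : ℕ} {e : ℤ}
    (hN : ∀ u : ℤ, 0 ≤ u → u ≤ |q₁ - q₂| → u % 2 = (r₁ - r₂) % 2 →
      ∃ j < N, u = 2 * (j : ℤ) + e) :
    #(ZerothHomotopy {x : KleinBottle | kleinStdMap q₁ r₁ x = kleinStdMap q₂ r₂ x}) ≤ N := by
  set C := {x : KleinBottle | kleinStdMap q₁ r₁ x = kleinStdMap q₂ r₂ x}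
  have hqR : (0 : ℝ) < |((q₁ - q₂ : ℤ) : ℝ)| := abs_pos.2 (by exact_mod_cast hq)
  let ξ : ℕ → ℝ := fun j => (2 * j + e) / (2 * |((q₁ - q₂ : ℤ) : ℝ)|)
  have key : ∀ c : ZerothHomotopy C, ∃ j : Fin N,
      ∃ h : Quot.mk kleinRel (0, ((ξ j : ℝ) : Circle1)) ∈ C, c = .mk ⟨_, h⟩ := by
    intro c
    obtain ⟨⟨y, hy⟩, rfl⟩ := ZerothHomotopy.mk_surjective c
    obtain ⟨t, x, hx0, hx1, rfl⟩ := exists_kleinBottle_rep y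
    have hC : ∀ s : ℝ, Quot.mk kleinRel (s, (x : Circle1)) ∈ C := fun s =>
      (kleinStdMap_eq_iff ..).2 ((kleinStdMap_eq_iff ..).1 hy)
    obtain ⟨k, hk⟩ := (kleinStdMap_eq_iff ..).1 hy
    have habs : |((q₁ - q₂ : ℤ) : ℝ)| * (2 * x) = (|2 * k - (r₁ - r₂)| : ℤ) := by
      push_cast at hk ⊢
      rw [← hk, add_sub_cancel_right, abs_mul, abs_of_nonneg (by positivity : 0 ≤ 2 * x)]
    obtain ⟨j, hj, hje⟩ := hN |2 * k - (r₁ - r₂)| (abs_nonneg _)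
      (by
        have : ((|2 * k - (r₁ - r₂)| : ℤ) : ℝ) ≤ (|q₁ - q₂| : ℤ) := by
          rw [← habs, Int.cast_abs]
          nlinarith
        exact_mod_cast this)
      (by rcases abs_cases (2 * k - (r₁ - r₂)) with h | h <;> omega)
    have hxj : x = ξ j := by
      rw [hje] at habs
      push_cast at habs
      simp only [ξ]
      field_simp
      push_cast
      linarith
    refine ⟨⟨j, hj⟩, hxj ▸ hC 0, ?_⟩
    subst hxj
    refine ZerothHomotopy.sound
      ⟨⟨fun s => ⟨Quot.mk kleinRel ((1 - (s : ℝ)) * t, ((ξ j : ℝ) : Circle1)), hC _⟩, ?_⟩, ?_, ?_⟩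
    · exact (continuous_quot_mk.comp (by fun_prop)).subtype_mk _
    · simp
    · simp
  choose J hJ hJ' using key
  have hinj : Function.Injective J := by
    intro c c' h
    rw [hJ' c, hJ' c']
    simp only [h]
  simpa using Cardinal.mk_le_of_injective hinj

/-- Theorem 1.3(ii), case `q ≠ 0`: for standard Klein bottle maps `g_{q₁,r₁}`, `g_{q₂,r₂}`
with `q := q₁ - q₂ ≠ 0` and `r := (r₁ - r₂) mod 2`, the minimum number of coincidence
components over `S¹` equals `|q|/2` if `q` is even and `r = 1`, and `⌊|q|/2⌋ + 1` otherwise. -/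
theorem klein_MCC_of_ne_zero (q₁ q₂ r₁ r₂ : ℤ)
    (hr₁ : r₁ = 0 ∨ r₁ = 1) (hr₂ : r₂ = 0 ∨ r₂ = 1)
    (hq : q₁ - q₂ ≠ 0) :
    MCCKlein (kleinStdMap q₁ r₁) (kleinStdMap q₂ r₂) =
      (if (q₁ - q₂) % 2 = 0 ∧ (r₁ - r₂) % 2 = 1 then (q₁ - q₂).natAbs / 2
        else (q₁ - q₂).natAbs / 2 + 1 : ℕ) := by
  set N : ℕ := if (q₁ - q₂) % 2 = 0 ∧ (r₁ - r₂) % 2 = 1 then (q₁ - q₂).natAbs / 2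
    else (q₁ - q₂).natAbs / 2 + 1 with hNdef
  have habs : |q₁ - q₂| = (q₁ - q₂).natAbs := Int.abs_eq_natAbs _
  let p₀ : {p : C(KleinBottle, KleinBottle) × C(KleinBottle, KleinBottle) //
      KleinHomotopicOver (kleinStdMap q₁ r₁) p.1 ∧ KleinHomotopicOver (kleinStdMap q₂ r₂) p.2} :=
    ⟨(kleinStdMap q₁ r₁, kleinStdMap q₂ r₂),
      kleinHomotopicOver_kleinStdMap q₁ r₁, kleinHomotopicOver_kleinStdMap q₂ r₂⟩
  have : Nonempty {p : C(KleinBottle, KleinBottle) × C(KleinBottle, KleinBottle) //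
      KleinHomotopicOver (kleinStdMap q₁ r₁) p.1 ∧ KleinHomotopicOver (kleinStdMap q₂ r₂) p.2} :=
    ⟨p₀⟩
  refine le_antisymm ((ciInf_le' _ p₀).trans ?_) (le_ciInf fun p => ?_)
  · refine mk_zerothHomotopy_kleinStdMap_le hq (e := (r₁ - r₂) % 2) fun u hu hu' hu2 => ?_
    refine ⟨(u / 2).toNat, ?_, ?_⟩
    · split_ifs at hNdef <;> omega
    · omega
  · refine le_mk_zerothHomotopy_coincidence p.2.1 p.2.2 hq (e := (r₁ - r₂) % 2) ?_ ?_
      fun j hj => ?_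
    · omega
    · omega
    · split_ifs at hNdef <;> omega
end
end

section
/- For integers q ≠ 0 and r, the number of equivalence classes of the equivalence relation R on ℤ defined by R(m,n) ⟺ (q ∣ m − n) ∨ (q ∣ m + n − r) equals |q|/2 if q is even and r is odd, and equals ⌊|q|/2⌋ + 1 otherwise. (The Reidemeister number over S¹ of a pair of fibre-preserving maps of the Klein bottle, Proposition 3.1, case q ≠ 0.) -/
/-- The Reidemeister relation over `S¹` on `ℤ ≅ π₁(fibre)` for a pair of fibre-preserving
maps of the Klein bottle with invariants `q` and `r`:
`m` and `n` are related iff `q ∣ m - n` or `q ∣ m + n - r`. -/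
def kleinReidemeisterRel (q r : ℤ) : ℤ → ℤ → Prop :=
  fun m n => q ∣ m - n ∨ q ∣ m + n - r

theorem kleinReidemeisterRel_equivalence (q r : ℤ) :
    Equivalence (kleinReidemeisterRel q r) where
  refl m := Or.inl (by simp)
  symm := by
    rintro m n (⟨a, ha⟩ | ⟨a, ha⟩)
    · exact Or.inl ⟨-a, by linear_combination -ha⟩
    · exact Or.inr ⟨a, by linear_combination ha⟩
  trans := by
    rintro m n k (⟨a, ha⟩ | ⟨a, ha⟩) (⟨b, hb⟩ | ⟨b, hb⟩)
    · exact Or.inl ⟨a + b, by linear_combination ha + hb⟩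
    · exact Or.inr ⟨a + b, by linear_combination ha + hb⟩
    · exact Or.inr ⟨a - b, by linear_combination ha - hb⟩
    · exact Or.inl ⟨a - b, by linear_combination ha - hb⟩

theorem quot_mk_kleinReidemeisterRel_eq_iff {q r m n : ℤ} :
    Quot.mk (kleinReidemeisterRel q r) m = Quot.mk (kleinReidemeisterRel q r) n ↔
      kleinReidemeisterRel q r m n := by
  rw [Quot.eq, (kleinReidemeisterRel_equivalence q r).eqvGen_iff]

/-- For `r = 2 * c + e` with `e ∈ {0, 1}`, the integers `c + e + i` with `0 ≤ 2 * i ≤ |q| - e`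
form a complete set of representatives. -/
theorem bijective_kleinReidemeisterRel_representatives {q r c e : ℤ} {k : ℕ} (hq : q ≠ 0)
    (hr : r = 2 * c + e) (he : e = 0 ∨ e = 1) (hk : (k : ℤ) = (|q| + 2 - e) / 2) :
    Function.Bijective
      (fun i : Fin k => Quot.mk (kleinReidemeisterRel q r) (c + e + (i : ℕ))) := by
  have hpos : 0 < |q| := abs_pos.mpr hq
  constructor
  · rintro ⟨i, hi⟩ ⟨j, hj⟩ h
    rw [Fin.mk.injEq]
    rcases quot_mk_kleinReidemeisterRel_eq_iff.mp h with h | h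
    · have h' := Int.eq_zero_of_abs_lt_dvd ((abs_dvd _ _).mpr h)
        (abs_lt.mpr ⟨by dsimp only; omega, by dsimp only; omega⟩)
      dsimp only at h'
      omega
    · dsimp only at h
      have hsum : |q| ∣ e + i + j := by
        obtain ⟨a, ha⟩ := h
        exact (abs_dvd _ _).mpr ⟨a, by linear_combination ha + hr⟩
      by_cases hlt : e + i + j < |q|
      · have := Int.eq_zero_of_dvd_of_nonneg_of_lt (by omega) hlt hsum
        omega
      · omega
  · rintro ⟨m⟩
    have hnonneg := Int.emod_nonneg (m - c - e) hpos.ne'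
    have hlt := Int.emod_lt_of_pos (m - c - e) hpos
    have hdiv := Int.emod_add_mul_ediv (m - c - e) |q|
    set t := (m - c - e) % |q|
    set s := (m - c - e) / |q|
    by_cases ht : 2 * t ≤ |q| - e
    · refine ⟨⟨t.toNat, by omega⟩, quot_mk_kleinReidemeisterRel_eq_iff.mpr (Or.inl ?_)⟩
      rw [← abs_dvd, Int.toNat_of_nonneg hnonneg]
      exact ⟨-s, by linear_combination hdiv⟩
    · refine ⟨⟨(|q| - e - t).toNat, by omega⟩,
        quot_mk_kleinReidemeisterRel_eq_iff.mpr (Or.inr ?_)⟩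
      rw [← abs_dvd, Int.toNat_of_nonneg (by omega)]
      exact ⟨s + 1, by linear_combination -hdiv - hr⟩

/-- Proposition 3.1, case `q ≠ 0`: the number of equivalence classes of the relation
`R(m,n) ⟺ (q ∣ m - n) ∨ (q ∣ m + n - r)` on `ℤ` equals `|q|/2` if `q` is even and `r` is
odd, and `⌊|q|/2⌋ + 1` otherwise. -/
theorem kleinReidemeisterRel_card (q r : ℤ) (hq : q ≠ 0) :
    Nat.card (Quot (kleinReidemeisterRel q r)) =
      if Even q ∧ Odd r then q.natAbs / 2 else q.natAbs / 2 + 1 := by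
  have hk : ((if Even q ∧ Odd r then q.natAbs / 2 else q.natAbs / 2 + 1 : ℕ) : ℤ) =
      (|q| + 2 - r % 2) / 2 := by
    simp only [Int.abs_eq_natAbs, Int.even_iff, Int.odd_iff]
    split_ifs <;> omega
  rw [← Nat.card_eq_of_bijective _ (bijective_kleinReidemeisterRel_representatives hq
    (by omega : r = 2 * (r / 2) + r % 2) (Int.emod_two_eq_zero_or_one r) hk), Nat.card_fin]
end

section
/- Let p_M : M → B and p_N : N → B be continuous maps between topological spaces and let f₁, f₂, f₁', f₂' : M → N be maps over B with f₁ homotopic over B to f₁' and f₂ homotopic over B to f₂'. Then there is a bijection between the set of path components of E_B(f₁,f₂) and the set of path components of E_B(f₁',f₂'). In particular the Reidemeister number over B, #R_B(f₁,f₂) := #π₀(E_B(f₁,f₂)), depends only on the homotopy classes over B of f₁ and f₂. (Corollary 3.1.) -/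
noncomputable section

variable {M N B : Type*} [TopologicalSpace M] [TopologicalSpace N] [TopologicalSpace B]

/-- Two maps `f, g : M → N` are homotopic over `B` (with respect to `p_M : M → B` and
`p_N : N → B`) if there is a homotopy `H` between them with `p_N ∘ H (s, ·) = p_M` for all
`s`. -/
def HomotopicOverBase (pM : C(M, B)) (pN : C(N, B)) (f g : C(M, N)) : Prop :=
  ∃ H : ContinuousMap.Homotopy f g, ∀ (s : unitInterval) (x : M), pN (H (s, x)) = pM x

/-- The space `E_B(f₁, f₂)`: the subspace of `M × C([0,1], N)` of pairs `(x, θ)` such that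
`θ` stays in the fibre of `p_N` over `p_M x` and runs from `f₁ x` to `f₂ x`. -/
def EBSpace (pM : C(M, B)) (pN : C(N, B)) (f₁ f₂ : C(M, N)) :
    Set (M × C(unitInterval, N)) :=
  {xθ | (∀ t : unitInterval, pN (xθ.2 t) = pM xθ.1) ∧ xθ.2 0 = f₁ xθ.1 ∧ xθ.2 1 = f₂ xθ.1}

open unitInterval

/-- Two continuous maps which are mutually inverse up to paths induce a bijection between the
sets of path components. -/
def ZerothHomotopy.equivOfJoined {X Y : Type*} [TopologicalSpace X] [TopologicalSpace Y]
    (f : C(X, Y)) (g : C(Y, X)) (hgf : ∀ x, Joined (g (f x)) x) (hfg : ∀ y, Joined (f (g y)) y) :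
    ZerothHomotopy X ≃ ZerothHomotopy Y where
  toFun := Quotient.map f fun _ _ h => h.map f.continuous
  invFun := Quotient.map g fun _ _ h => h.map g.continuous
  left_inv := by
    rintro ⟨x⟩
    exact Quotient.sound (hgf x)
  right_inv := by
    rintro ⟨y⟩
    exact Quotient.sound (hfg y)

/-- The total space of the family of spaces `E_B(H (s, ·), K (s, ·))` for `s ∈ [0, 1]`. -/
def EBFamily (pM : C(M, B)) (pN : C(N, B)) (H K : C(I × M, N)) :
    Set (I × M × C(I, N)) :=
  {z | (∀ t, pN (z.2.2 t) = pM z.2.1) ∧ z.2.2 0 = H (z.1, z.2.1) ∧ z.2.2 1 = K (z.1, z.2.1)}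

/-- The path of `z = (s, x, θ)`, extended beyond its ends by following the homotopies `H` and `K`
from time `s` back to time `0`. -/
def EBFamily.extend (H K : C(I × M, N)) (z : I × M × C(I, N)) (u : ℝ) : N :=
  if u ≤ 0 then H (Set.projIcc 0 1 zero_le_one (z.1 + u), z.2.1)
  else if u ≤ 1 then z.2.2 (Set.projIcc 0 1 zero_le_one u)
  else K (Set.projIcc 0 1 zero_le_one (z.1 + 1 - u), z.2.1)

namespace EBFamily

variable {pM : C(M, B)} {pN : C(N, B)} {H K : C(I × M, N)}

theorem extend_of_mem (z : EBFamily pM pN H K) (t : I) : extend H K z t = z.1.2.2 t := by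
  obtain ⟨⟨s, x, θ⟩, -, h0, -⟩ := z
  rcases eq_or_ne t 0 with rfl | ht
  · simpa [extend] using h0.symm
  · have h : ¬ (t : ℝ) ≤ 0 := not_le.2 (unitInterval.pos_iff_ne_zero.2 ht)
    simp [extend, h, t.2.2]

theorem extend_of_nonpos (z : I × M × C(I, N)) {u : ℝ} (hu : u ≤ 0) :
    extend H K z u = H (Set.projIcc 0 1 zero_le_one (z.1 + u), z.2.1) :=
  if_pos hu

theorem extend_of_one_le (z : EBFamily pM pN H K) {u : ℝ} (hu : 1 ≤ u) :
    extend H K z u = K (Set.projIcc 0 1 zero_le_one (z.1.1 + 1 - u), z.1.2.1) := by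
  rcases hu.eq_or_lt with rfl | hu
  · simpa using (extend_of_mem z 1).trans z.2.2.2
  · simp [extend, hu.not_ge, (zero_lt_one.trans hu).not_ge]

theorem map_extend (hH : ∀ s x, pN (H (s, x)) = pM x) (hK : ∀ s x, pN (K (s, x)) = pM x)
    (z : EBFamily pM pN H K) (u : ℝ) : pN (extend H K z u) = pM z.1.2.1 := by
  unfold extend
  split_ifs
  · exact hH _ _
  · exact z.2.1 _
  · exact hK _ _

theorem continuous_extend :
    Continuous fun q : EBFamily pM pN H K × ℝ => extend H K q.1 q.2 := by
  unfold extend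
  refine Continuous.if_le ?_ (Continuous.if_le ?_ ?_ continuous_snd continuous_const ?_)
    continuous_snd continuous_const ?_
  · fun_prop
  · fun_prop
  · fun_prop
  · rintro ⟨⟨⟨s, x, θ⟩, -, -, h1⟩, u⟩ rfl
    simpa using h1
  · rintro ⟨⟨⟨s, x, θ⟩, -, h0, -⟩, u⟩ rfl
    simpa using h0.symm

/-- The deformation of the family onto its part over `0`: at time `r` it takes `(s, x, θ)` to a
point over `s * (1 - r)`, prolonging `θ` at both ends along the homotopies. -/
def deform (hH : ∀ s x, pN (H (s, x)) = pM x) (hK : ∀ s x, pN (K (s, x)) = pM x) :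
    C(I × EBFamily pM pN H K, EBFamily pM pN H K) where
  toFun q := ⟨(q.2.1.1 * σ q.1, q.2.1.2.1,
      ⟨fun t => extend H K q.2 ((1 + 2 * (q.2.1.1 * q.1)) * t - q.2.1.1 * q.1),
        continuous_extend.comp (f := fun t : I =>
          (q.2, (1 + 2 * ((q.2.1.1 : ℝ) * q.1)) * t - q.2.1.1 * q.1)) (by fun_prop)⟩), by
    obtain ⟨r, z⟩ := q
    have hsr : 0 ≤ (z.1.1 : ℝ) * r := mul_nonneg z.1.1.2.1 r.2.1
    refine ⟨fun t => map_extend hH hK z _, ?_, ?_⟩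
    · have h : (z.1.1 : ℝ) + -(z.1.1 * r) = (z.1.1 * σ r : I) := by
        simp only [Set.Icc.coe_mul, coe_symm_eq]; ring
      simp only [ContinuousMap.coe_mk, Set.Icc.coe_zero, mul_zero, zero_sub]
      rw [extend_of_nonpos _ (by linarith), h, Set.projIcc_val]
    · have h : (z.1.1 : ℝ) + 1 - (1 + 2 * (z.1.1 * r) - z.1.1 * r) = (z.1.1 * σ r : I) := by
        simp only [Set.Icc.coe_mul, coe_symm_eq]; ring
      simp only [ContinuousMap.coe_mk, Set.Icc.coe_one, mul_one]
      rw [extend_of_one_le _ (by linarith), h, Set.projIcc_val]⟩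
  continuous_toFun := by
    refine Continuous.subtype_mk (Continuous.prodMk (by fun_prop) (Continuous.prodMk (by fun_prop)
      (ContinuousMap.continuous_of_continuous_uncurry _ ?_))) _
    exact continuous_extend.comp (f := fun p : (I × EBFamily pM pN H K) × I =>
      (p.1.2, (1 + 2 * ((p.1.2.1.1 : ℝ) * p.1.1)) * p.2 - p.1.2.1.1 * p.1.1)) (by fun_prop)

theorem deform_of_mul_eq_zero (hH : ∀ s x, pN (H (s, x)) = pM x)
    (hK : ∀ s x, pN (K (s, x)) = pM x) (r : I) (z : EBFamily pM pN H K)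
    (h : (z.1.1 : ℝ) * r = 0) : deform hH hK (r, z) = z := by
  refine Subtype.ext (Prod.ext (Subtype.ext ?_) (Prod.ext rfl (ContinuousMap.ext fun t => ?_)))
  · simp [deform, mul_sub, h]
  · simpa [deform, h] using extend_of_mem z t

/-- The family of spaces `E_B(H (s, ·), K (s, ·))` has the same path components as its member at
`s = 0`. -/
def zerothHomotopyEquiv {f g : C(M, N)} (hH : ∀ s x, pN (H (s, x)) = pM x)
    (hK : ∀ s x, pN (K (s, x)) = pM x) (hf : ∀ x, H (0, x) = f x) (hg : ∀ x, K (0, x) = g x) :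
    ZerothHomotopy (EBSpace pM pN f g) ≃ ZerothHomotopy (EBFamily pM pN H K) :=
  have deform_one_fst (z : EBFamily pM pN H K) : (deform hH hK (1, z)).1.1 = 0 := by
    simp [deform]
  have joined (z : EBFamily pM pN H K) : Joined (deform hH hK (1, z)) z :=
    Joined.symm ⟨{
      toFun r := deform hH hK (r, z)
      continuous_toFun := by fun_prop
      source' := deform_of_mul_eq_zero hH hK 0 z (by simp)
      target' := rfl }⟩
  let incl : C(EBSpace pM pN f g, EBFamily pM pN H K) :=
    { toFun := fun e => ⟨(0, e.1), e.2.1, e.2.2.1.trans (hf _).symm, e.2.2.2.trans (hg _).symm⟩ }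
  let retr : C(EBFamily pM pN H K, EBSpace pM pN f g) :=
    { toFun := fun z => ⟨(deform hH hK (1, z)).1.2, (deform hH hK (1, z)).2.1,
        by rw [(deform hH hK (1, z)).2.2.1, deform_one_fst, hf],
        by rw [(deform hH hK (1, z)).2.2.2, deform_one_fst, hg]⟩
      continuous_toFun := ((continuous_subtype_val.comp
        ((deform hH hK).continuous.comp (Continuous.prodMk_right 1))).snd).subtype_mk _ }
  ZerothHomotopy.equivOfJoined incl retr
    (fun e => by
      have h : retr (incl e) = e := Subtype.ext (congrArg (fun z => z.1.2)
        (deform_of_mul_eq_zero hH hK 1 (incl e) (by simp [incl])))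
      rw [h])
    (fun z => by
      have h : incl (retr z) = deform hH hK (1, z) :=
        Subtype.ext (Prod.ext (deform_one_fst z).symm rfl)
      rw [h]
      exact joined z)

/-- Reversing the parameter of the family. -/
def reverse {H' K' : C(I × M, N)} (hH : ∀ s x, H' (σ s, x) = H (s, x))
    (hK : ∀ s x, K' (σ s, x) = K (s, x)) : C(EBFamily pM pN H K, EBFamily pM pN H' K') where
  toFun z := ⟨(σ z.1.1, z.1.2), z.2.1, z.2.2.1.trans (hH _ _).symm, z.2.2.2.trans (hK _ _).symm⟩

/-- Reversing the parameter of the family does not change the path components. -/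
def zerothHomotopyReverseEquiv {f f' g g' : C(M, N)} (F : f.Homotopy f') (G : g.Homotopy g') :
    ZerothHomotopy (EBFamily pM pN F.toContinuousMap G.toContinuousMap) ≃
      ZerothHomotopy (EBFamily pM pN F.symm.toContinuousMap G.symm.toContinuousMap) :=
  ZerothHomotopy.equivOfJoined
    (reverse (fun s x => congrArg (fun t => F (t, x)) (symm_symm s))
      (fun s x => congrArg (fun t => G (t, x)) (symm_symm s)))
    (reverse (fun _ _ => rfl) (fun _ _ => rfl))
    (fun z => by
      convert Joined.refl z
      exact Subtype.ext (Prod.ext (symm_symm z.1.1) rfl))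
    (fun z => by
      convert Joined.refl z
      exact Subtype.ext (Prod.ext (symm_symm z.1.1) rfl))

end EBFamily

/-- Corollary 3.1: if `f₁ ∼_B f₁'` and `f₂ ∼_B f₂'`, then the sets of path components of
`E_B(f₁, f₂)` and of `E_B(f₁', f₂')` are in bijection; in particular the Reidemeister number
over `B`, `#R_B(f₁,f₂) = #π₀(E_B(f₁,f₂))`, depends only on the homotopy classes over `B` of
`f₁` and `f₂`. -/
theorem zerothHomotopy_EBSpace_equiv_of_homotopicOver
    (pM : C(M, B)) (pN : C(N, B)) (f₁ f₂ f₁' f₂' : C(M, N))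
    (h₁ : HomotopicOverBase pM pN f₁ f₁') (h₂ : HomotopicOverBase pM pN f₂ f₂') :
    Nonempty (ZerothHomotopy (EBSpace pM pN f₁ f₂) ≃ ZerothHomotopy (EBSpace pM pN f₁' f₂')) := by
  obtain ⟨F, hF⟩ := h₁
  obtain ⟨G, hG⟩ := h₂
  exact ⟨(EBFamily.zerothHomotopyEquiv (H := F.toContinuousMap) (K := G.toContinuousMap)
      hF hG F.apply_zero G.apply_zero).trans <|
    (EBFamily.zerothHomotopyReverseEquiv F G).trans
      (EBFamily.zerothHomotopyEquiv (H := F.symm.toContinuousMap) (K := G.symm.toContinuousMap)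
        (fun s => hF (σ s)) (fun s => hG (σ s)) F.symm.apply_zero G.symm.apply_zero).symm⟩
end
end

section
/- Let p_M : M → B and p_N : N → B be continuous maps and f₁, f₂ : M → N maps over B. For coincidence points x, x' ∈ C(f₁,f₂), the following are equivalent: (1) x and x' are Nielsen equivalent over B, i.e. there exist a path c : [0,1] → M from x to x' and a continuous map h : [0,1] × [0,1] → N with h(s,0) = f₁(c(s)) and h(s,1) = f₂(c(s)) for all s, with h(0,t) = f₁(x) and h(1,t) = f₂(x') for all t, and with p_N(h(s,t)) = p_M(c(s)) for all s, t; (2) the points (x, constant path at f₁(x)) and (x', constant path at f₁(x')) lie in the same path component of E_B(f₁,f₂). (Proposition 4.1.) -/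
noncomputable section

variable {M N B : Type*} [TopologicalSpace M] [TopologicalSpace N] [TopologicalSpace B]

/-- Proposition 4.1: two coincidence points `x, x'` of a pair `(f₁, f₂)` of maps over `B`
are Nielsen equivalent over `B` (via a path `c` from `x` to `x'` and a fibrewise homotopy `h`
from `f₁ ∘ c` to `f₂ ∘ c`) if and only if the corresponding points
`(x, constant path at f₁ x)` and `(x', constant path at f₁ x')` lie in the same path
component of `E_B(f₁, f₂)`. -/
theorem nielsenEquivalent_iff_joined
    (pM : C(M, B)) (pN : C(N, B)) (f₁ f₂ : C(M, N))
    (hf₁ : ∀ x, pN (f₁ x) = pM x) (hf₂ : ∀ x, pN (f₂ x) = pM x)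
    (x x' : M) (hx : f₁ x = f₂ x) (hx' : f₁ x' = f₂ x') :
    (∃ (c : Path x x') (h : C(unitInterval × unitInterval, N)),
        (∀ s, h (s, 0) = f₁ (c s)) ∧ (∀ s, h (s, 1) = f₂ (c s)) ∧
        (∀ t, h (0, t) = f₁ x) ∧ (∀ t, h (1, t) = f₂ x') ∧
        (∀ s t, pN (h (s, t)) = pM (c s))) ↔
      Joined
        (⟨(x, ContinuousMap.const unitInterval (f₁ x)),
          fun _ => hf₁ x, rfl, hx⟩ : EBSpace pM pN f₁ f₂)
        (⟨(x', ContinuousMap.const unitInterval (f₁ x')),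
          fun _ => hf₁ x', rfl, hx'⟩ : EBSpace pM pN f₁ f₂) := by
  constructor
  · rintro ⟨c, h, h0, h1, hl, hr, hp⟩
    refine ⟨⟨⟨fun s => ⟨(c s, h.curry s), fun t => hp s t, h0 s, h1 s⟩, ?_⟩, ?_, ?_⟩⟩
    · exact (c.continuous.prodMk h.curry.continuous).subtype_mk _
    · refine Subtype.ext (Prod.ext c.source (ContinuousMap.ext fun t => ?_))
      exact hl t
    · refine Subtype.ext (Prod.ext c.target (ContinuousMap.ext fun t => ?_))
      exact (hr t).trans hx'.symm
  · rintro ⟨γ⟩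
    have hγ : Continuous fun s => (γ s : M × C(unitInterval, N)) :=
      continuous_subtype_val.comp γ.continuous
    let c : Path x x' :=
      { toFun := fun s => (γ s).1.1
        continuous_toFun := hγ.fst
        source' := by rw [γ.source]
        target' := by rw [γ.target] }
    let θ : C(unitInterval, C(unitInterval, N)) := ⟨fun s => (γ s).1.2, hγ.snd⟩
    refine ⟨c, θ.uncurry, fun s => (γ s).2.2.1, fun s => (γ s).2.2.2, fun t => ?_, fun t => ?_,
      fun s t => (γ s).2.1 t⟩
    · change (γ 0).1.2 t = f₁ x
      rw [γ.source]
      rfl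
    · change (γ 1).1.2 t = f₂ x'
      rw [γ.target]
      exact hx'
end
end
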